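/- arXiv:1703.07994 — 4 statements merged into one kernel-verified Lean document; each statement's English description precedes it below -/
import Mathlib

section
/- Let O be a UCQ rewritable OMQ language with bounding function f_O, and let Q ∈ O and Q' ∈ (TGD, CQ) be OMQs with the same data schema S. If Q is not contained in Q', then there exists an S-database D with at most f_O(Q) facts such that Q(D) is not a subset of Q'(D). -/
/-! Core formalization: relational instances, conjunctive queries,
tuple-generating dependencies (tgds) and ontology-mediated queries (OMQs). -/

/-- A schema: a list of (predicate name, arity) pairs. -/
abbrev RSig : Type := List (ℕ × ℕ)

/-- Terms populating instances: constants (`Sum.inl`) or labeled nulls (`Sum.inr`). -/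
abbrev GTerm : Type := ℕ ⊕ ℕ

/-- Terms of queries and tgds: constants (`Sum.inl`) or variables (`Sum.inr`). -/
abbrev QTerm : Type := ℕ ⊕ ℕ

/-- A relational atom over terms of type `T`: a predicate name and a tuple of terms. -/
abbrev RAtom (T : Type) : Type := ℕ × List T

/-- A fact: an atom whose arguments are constants. -/
abbrev DBFact : Type := RAtom ℕ

/-- A database: a finite list of facts. -/
abbrev Database : Type := List DBFact

/-- An instance with domain `α`. -/
abbrev GInst (α : Type) : Type := Set (RAtom α)

/-- An instance over constants and labeled nulls. -/
abbrev Inst : Type := GInst GTerm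

def factAtom (f : DBFact) : RAtom GTerm := (f.1, f.2.map Sum.inl)

/-- The instance corresponding to a database. -/
def dbInst (D : Database) : Inst := {a | ∃ f ∈ D, factAtom f = a}

def atomOverSig {T : Type} (S : RSig) (a : RAtom T) : Prop := (a.1, a.2.length) ∈ S

/-- `D` is a database over the schema `S`. -/
def DBover (S : RSig) (D : Database) : Prop := ∀ f ∈ D, atomOverSig S f

/-- `I` is an instance over the schema `S`. -/
def InstOver (S : RSig) (I : Inst) : Prop := ∀ a ∈ I, atomOverSig S a

/-- Active domain of a database. -/
def adomD (D : Database) : Set ℕ := {c | ∃ f ∈ D, c ∈ f.2}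

/-- Active domain of an instance. -/
def instAdom {α : Type} (I : GInst α) : Set α := {s | ∃ a ∈ I, s ∈ a.2}

/-- `c` is a tuple from `adom(D)^n`. -/
def TupleIn (D : Database) (n : ℕ) (c : List ℕ) : Prop :=
  c.length = n ∧ ∀ x ∈ c, x ∈ adomD D

/-- Variable assignments into the domain of instances. -/
abbrev Assign : Type := ℕ → GTerm

def applyT (ν : Assign) : QTerm → GTerm := Sum.elim Sum.inl ν

def applyA (ν : Assign) (a : RAtom QTerm) : RAtom GTerm := (a.1, a.2.map (applyT ν))

/-- A tgd, given as a pair (body, head) of lists of atoms. -/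
abbrev TGD : Type := List (RAtom QTerm) × List (RAtom QTerm)

/-- Variables occurring in a list of atoms. -/
def varsOf (as : List (RAtom QTerm)) : Set ℕ := {v | ∃ a ∈ as, (Sum.inr v : QTerm) ∈ a.2}

/-- Satisfaction of a tgd by an instance: every homomorphic image of the body
extends to a homomorphic image of the head (variables not occurring in the body
are existentially quantified). -/
def satTGD (I : Inst) (τ : TGD) : Prop :=
  ∀ ν : Assign, (∀ a ∈ τ.1, applyA ν a ∈ I) →
    ∃ ν' : Assign, (∀ v ∈ varsOf τ.1, ν' v = ν v) ∧ ∀ a ∈ τ.2, applyA ν' a ∈ I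

def satAll (I : Inst) (Sg : List TGD) : Prop := ∀ τ ∈ Sg, satTGD I τ

/-- A fact tgd: a tgd with empty body. -/
def IsFactTGD (τ : TGD) : Prop := τ.1 = []

/-- A class of (finite sets of) tgds closed under fact tgd extension. -/
def FactClosed (C : Set (List TGD)) : Prop :=
  ∀ Sg ∈ C, ∀ F : List TGD, (∀ τ ∈ F, IsFactTGD τ) → (Sg ++ F) ∈ C

/-- A conjunctive query: (list of free variables, body atoms). -/
abbrev CQ : Type := List ℕ × List (RAtom QTerm)

/-- A union of conjunctive queries. -/
abbrev UCQ : Type := List CQ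

/-- Evaluation of a CQ over an instance: the set of answer tuples of constants. -/
def evalCQ (q : CQ) (I : Inst) : Set (List ℕ) :=
  {c | ∃ ν : Assign, (∀ a ∈ q.2, applyA ν a ∈ I) ∧ q.1.map ν = c.map Sum.inl}

def evalUCQ (u : UCQ) (I : Inst) : Set (List ℕ) := {c | ∃ q ∈ u, c ∈ evalCQ q I}

/-- The predicates (with their arities) occurring in a finite set of tgds. -/
def schList (Sg : List TGD) : RSig :=
  Sg.flatMap (fun τ => (τ.1 ++ τ.2).map (fun a => (a.1, a.2.length)))

/-- Certain answers of a CQ w.r.t. an instance and a set of tgds. -/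
def certAnsI (Sg : List TGD) (q : CQ) (I : Inst) : Set (List ℕ) :=
  {c | ∀ J : Inst, I ⊆ J → satAll J Sg → c ∈ evalCQ q J}

/-- Certain answers of a CQ w.r.t. a database and a set of tgds. -/
def certAns (Sg : List TGD) (q : CQ) (D : Database) : Set (List ℕ) :=
  certAnsI Sg q (dbInst D)

/-- Certain answers of a UCQ w.r.t. a database and a set of tgds. -/
def certAnsU (Sg : List TGD) (u : UCQ) (D : Database) : Set (List ℕ) :=
  {c | ∀ J : Inst, dbInst D ⊆ J → satAll J Sg → c ∈ evalUCQ u J}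

/-- An ontology-mediated query: (data schema, set of tgds, CQ). -/
abbrev OMQ : Type := RSig × List TGD × CQ

/-- Evaluation of an OMQ over a database: the certain answers. -/
def omqEval (Q : OMQ) (D : Database) : Set (List ℕ) := certAns Q.2.1 Q.2.2 D

/-- Containment of two OMQs over the common data schema of `Q1`. -/
def omqContained (Q1 Q2 : OMQ) : Prop :=
  ∀ D : Database, DBover Q1.1 D → omqEval Q1 D ⊆ omqEval Q2 D

/-- `u` is a UCQ rewriting of the OMQ `Q` over its data schema: a UCQ over the
data schema, with the same free variables, whose evaluation coincides with the
evaluation of `Q` over every database over the data schema. -/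
def IsUCQRewriting (Q : OMQ) (u : UCQ) : Prop :=
  (∀ p ∈ u, p.1 = Q.2.2.1 ∧ ∀ a ∈ p.2, atomOverSig Q.1 a) ∧
  ∀ D : Database, DBover Q.1 D → evalUCQ u (dbInst D) = omqEval Q D

/-- `O` is a UCQ rewritable OMQ language with bounding function `f`: each of its
OMQs has a UCQ rewriting every disjunct of which has at most `f Q` atoms. -/
def UCQRewritableWith (O : Set OMQ) (f : OMQ → ℕ) : Prop :=
  ∀ Q ∈ O, ∃ u : UCQ, IsUCQRewriting Q u ∧ ∀ p ∈ u, p.2.length ≤ f Q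

/-- Certain answers are monotone in the database. -/
theorem certAns_mono (Sg : List TGD) (q : CQ) {D E : Database} (h : D ⊆ E) :
    certAns Sg q D ⊆ certAns Sg q E := by
  intro c hc J hJ hsat
  refine hc J ?_ hsat
  rintro _ ⟨g, hg, rfl⟩
  exact hJ ⟨g, h hg, rfl⟩

/-- An answer of a CQ over a database is already an answer over a subdatabase
with at most one fact per atom of the query. -/
theorem exists_small_subdatabase {p : CQ} {E : Database} {c : List ℕ}
    (hc : c ∈ evalCQ p (dbInst E)) :
    ∃ D : Database, D ⊆ E ∧ D.length = p.2.length ∧ c ∈ evalCQ p (dbInst D) := by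
  obtain ⟨ν, hν, hans⟩ := hc
  have hex : ∀ a, ∃ g : DBFact, a ∈ p.2 → g ∈ E ∧ factAtom g = applyA ν a := by
    intro a
    by_cases ha : a ∈ p.2
    · obtain ⟨g, hg, hga⟩ := hν a ha
      exact ⟨g, fun _ => ⟨hg, hga⟩⟩
    · exact ⟨(0, []), fun h => absurd h ha⟩
  choose g hg using hex
  refine ⟨p.2.map g, ?_, List.length_map _, ν, ?_, hans⟩
  · intro x hx
    obtain ⟨a, ha, rfl⟩ := List.mem_map.1 hx
    exact (hg a ha).1
  · intro a ha
    exact ⟨g a, List.mem_map_of_mem ha, (hg a ha).2⟩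

/-- small witness property.
Let `O` be a UCQ rewritable OMQ language with bounding function `f`, and let
`Q ∈ O` and `Q' ∈ (TGD, CQ)` have the same data schema `S`.  If `Q ⊄ Q'`, then
there is an `S`-database `D` with at most `f Q` facts such that
`Q(D) ⊄ Q'(D)`. -/
theorem statement_4 (O : Set OMQ) (f : OMQ → ℕ)
    (hO : UCQRewritableWith O f)
    (Q Q' : OMQ) (hQ : Q ∈ O) (hS : Q'.1 = Q.1)
    (hnc : ¬ omqContained Q Q') :
    ∃ D : Database, DBover Q.1 D ∧ D.toFinset.card ≤ f Q ∧
      ¬ (omqEval Q D ⊆ omqEval Q' D) := by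
  unfold omqContained at hnc
  push Not at hnc
  obtain ⟨E, hE, hsub⟩ := hnc
  obtain ⟨c, hcQ, hcQ'⟩ := Set.not_subset.1 hsub
  obtain ⟨u, ⟨-, hu⟩, hlen⟩ := hO Q hQ
  rw [← hu E hE] at hcQ
  obtain ⟨p, hp, hcp⟩ := hcQ
  obtain ⟨D, hDE, hcard, hcD⟩ := exists_small_subdatabase hcp
  have hD : DBover Q.1 D := fun g hg => hE g (hDE hg)
  refine ⟨D, hD, (List.toFinset_card_le D).trans (hcard.trans_le (hlen p hp)), fun hcon => ?_⟩
  refine hcQ' (certAns_mono _ _ hDE (hcon ?_))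
  rw [← hu D hD]
  exact ⟨p, hp, hcD⟩
end

section
/- There are families {Q_1^n = (S, Σ_1^n, q_1)}_{n>0} and {Q_2^n = (S, Σ_2^n, q_2)}_{n>0} of OMQs from (NR, CQ) over a common data schema S, with |sch(Σ_1^n)| = |sch(Σ_2^n)| = n+2, such that for every n > 0 and every S-database D, if Q_1^n(D) ⊄ Q_2^n(D) then |D| ≥ 2^{n-1}. Hence the exponential bound on witnesses to non-containment of non-recursive OMQs is optimal. -/
/-- A tgd is guarded if some body atom contains all body variables. -/
def GuardedTGD (τ : TGD) : Prop :=
  ∃ g ∈ τ.1, ∀ v ∈ varsOf τ.1, (Sum.inr v : QTerm) ∈ g.2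

/-- A tgd is linear if its body consists of a single atom. -/
def LinearTGD (τ : TGD) : Prop := τ.1.length = 1

/-- Edge of the predicate graph of a set of tgds. -/
def predEdge (Sg : List TGD) (R P : ℕ) : Prop :=
  ∃ τ ∈ Sg, (∃ a ∈ τ.1, a.1 = R) ∧ (∃ b ∈ τ.2, b.1 = P)

/-- A finite set of tgds is non-recursive if its predicate graph is acyclic. -/
def NonRecursive (Sg : List TGD) : Prop :=
  ∀ R : ℕ, ¬ Relation.TransGen (predEdge Sg) R R

/-- The inductive variable-marking procedure of Calì, Gottlob and Pieris:
`Marked Sg σ x` says that the body variable `x` of `σ` is marked in `Sg`. -/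
inductive Marked (Sg : List TGD) : TGD → ℕ → Prop where
  | base (σ : TGD) (x : ℕ) (hσ : σ ∈ Sg) (hx : x ∈ varsOf σ.1)
      (α : RAtom QTerm) (hα : α ∈ σ.2) (hnx : (Sum.inr x : QTerm) ∉ α.2) :
      Marked Sg σ x
  | prop (σ : TGD) (x : ℕ) (hσ : σ ∈ Sg) (hx : x ∈ varsOf σ.1)
      (α : RAtom QTerm) (hα : α ∈ σ.2) (hxα : (Sum.inr x : QTerm) ∈ α.2)
      (σ' : TGD) (hσ' : σ' ∈ Sg) (β : RAtom QTerm) (hβ : β ∈ σ'.1)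
      (hpred : β.1 = α.1) (hlen : β.2.length = α.2.length)
      (hmk : ∀ i y : ℕ, α.2[i]? = some (Sum.inr x) →
        β.2[i]? = some (Sum.inr y) → Marked Sg σ' y) :
      Marked Sg σ x

/-- A finite set of tgds is sticky if no tgd contains two occurrences
(in its body) of a marked variable. -/
def Sticky (Sg : List TGD) : Prop :=
  ∀ σ ∈ Sg, ∀ x : ℕ, Marked Sg σ x →
    (σ.1.map (fun a => a.2.count (Sum.inr x : QTerm))).sum ≤ 1

/-- Number of predicates occurring in `Sg`. -/
def schCount (Sg : List TGD) : ℕ := (schList Sg).dedup.length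

/-! ### Full tgds over binary predicates -/

/-- The atom `p(u, v)` over variables `u` and `v`. -/
def binAtom (p u v : ℕ) : RAtom QTerm := (p, [Sum.inr u, Sum.inr v])

/-- The tgd `p(x, y) → r(x, y)`. -/
def copyRule (p r : ℕ) : TGD := ([binAtom p 0 1], [binAtom r 0 1])

/-- The tgd `p(x, y) ∧ p(y, z) → r(x, z)`. -/
def compRule (p r : ℕ) : TGD := ([binAtom p 0 1, binAtom p 1 2], [binAtom r 0 2])

/-- The tgd `p(u, v) → r()`. -/
def goalRule (p u v r : ℕ) : TGD := ([binAtom p u v], [(r, [])])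

lemma satTGD_iff_of_full {I : Inst} {τ : TGD} (h : varsOf τ.2 ⊆ varsOf τ.1) :
    satTGD I τ ↔ ∀ ν : Assign, (∀ a ∈ τ.1, applyA ν a ∈ I) → ∀ a ∈ τ.2, applyA ν a ∈ I := by
  refine forall_congr' fun ν => imp_congr_right fun _ => ⟨?_, fun H => ⟨ν, fun _ _ => rfl, H⟩⟩
  rintro ⟨ν', hν', H⟩ a ha
  have : applyA ν a = applyA ν' a := by
    refine Prod.ext rfl (List.map_congr_left fun t ht => ?_)
    rcases t with c | v
    · rfl
    · exact (hν' v (h ⟨a, ha, ht⟩)).symm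
  exact this ▸ H a ha

lemma satTGD_copyRule {I : Inst} {p r : ℕ} :
    satTGD I (copyRule p r) ↔ ∀ x y, (p, [x, y]) ∈ I → (r, [x, y]) ∈ I := by
  rw [satTGD_iff_of_full (by intro v; simp [varsOf, copyRule, binAtom])]
  simp only [copyRule, binAtom, applyA, applyT, List.mem_singleton, forall_eq, List.map_cons,
    List.map_nil, Sum.elim_inr]
  exact ⟨fun H x y => H (fun i => if i = 0 then x else y), fun H ν => H _ _⟩

lemma satTGD_compRule {I : Inst} {p r : ℕ} :
    satTGD I (compRule p r) ↔
      ∀ x y z, (p, [x, y]) ∈ I → (p, [y, z]) ∈ I → (r, [x, z]) ∈ I := by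
  rw [satTGD_iff_of_full (by intro v; simp [varsOf, compRule, binAtom]; tauto)]
  simp only [compRule, binAtom, applyA, applyT, List.mem_cons, List.not_mem_nil, or_false,
    forall_eq_or_imp, forall_eq, List.map_cons, List.map_nil, Sum.elim_inr, and_imp]
  exact ⟨fun H x y z => H (fun i => if i = 0 then x else if i = 1 then y else z),
    fun H ν => H _ _ _⟩

lemma satTGD_goalRule_pair {I : Inst} {p r : ℕ} :
    satTGD I (goalRule p 0 1 r) ↔ ∀ x y, (p, [x, y]) ∈ I → (r, []) ∈ I := by
  rw [satTGD_iff_of_full (by intro v; simp [varsOf, goalRule])]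
  simp only [goalRule, binAtom, applyA, applyT, List.mem_singleton, forall_eq, List.map_cons,
    List.map_nil, Sum.elim_inr]
  exact ⟨fun H x y => H (fun i => if i = 0 then x else y), fun H ν => H _ _⟩

lemma satTGD_goalRule_diag {I : Inst} {p r : ℕ} :
    satTGD I (goalRule p 0 0 r) ↔ ∀ x, (p, [x, x]) ∈ I → (r, []) ∈ I := by
  rw [satTGD_iff_of_full (by intro v; simp [varsOf, goalRule])]
  simp only [goalRule, binAtom, applyA, applyT, List.mem_singleton, forall_eq, List.map_cons,
    List.map_nil, Sum.elim_inr]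
  exact ⟨fun H x => H (fun _ => x), fun H ν => H _⟩

lemma nonRecursive_of_rank {Sg : List TGD} (rk : ℕ → ℕ)
    (h : ∀ τ ∈ Sg, ∀ a ∈ τ.1, ∀ b ∈ τ.2, rk a.1 < rk b.1) : NonRecursive Sg := by
  have key : ∀ R P, Relation.TransGen (predEdge Sg) R P → rk R < rk P := by
    have edge : ∀ R P, predEdge Sg R P → rk R < rk P := by
      rintro _ _ ⟨τ, hτ, ⟨a, ha, rfl⟩, b, hb, rfl⟩
      exact h τ hτ a ha b hb
    intro R P hRP
    induction hRP with
    | single hs => exact edge _ _ hs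
    | tail _ hs ih => exact ih.trans (edge _ _ hs)
  exact fun R hR => lt_irrefl _ (key R R hR)

/-! ### The two families

Predicate `0` is the binary edge predicate of the data schema, predicate `1` is the nullary goal,
and predicate `j + 2` stores walks whose length is exactly (resp. at most) `2 ^ j`. -/

/-- The goal is derived when there is a walk of length exactly `2 ^ (n - 1)`. -/
def longWalkTGDs (n : ℕ) : List TGD :=
  copyRule 0 2 :: goalRule (n + 1) 0 1 1 ::
    (List.range (n - 1)).map fun j => compRule (j + 2) (j + 3)

/-- The goal is derived when there is a closed walk of positive length at most `2 ^ (n - 1)`. -/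
def closedWalkTGDs (n : ℕ) : List TGD :=
  copyRule 0 2 :: goalRule (n + 1) 0 0 1 ::
    ((List.range (n - 1)).map (fun j => compRule (j + 2) (j + 3)) ++
      (List.range (n - 1)).map fun j => copyRule (j + 2) (j + 3))

/-- The Boolean query asking for the goal predicate. -/
def goalQuery : CQ := ([], [(1, [])])

lemma mem_evalCQ_goalQuery {I : Inst} {c : List ℕ} :
    c ∈ evalCQ goalQuery I ↔ (1, []) ∈ I ∧ c = [] := by
  simp only [evalCQ, goalQuery, applyA, Set.mem_ofPred_eq, List.mem_singleton, forall_eq,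
    List.map_nil, exists_const, List.nil_eq, List.map_eq_nil_iff]

lemma satAll_longWalkTGDs {I : Inst} {m : ℕ} :
    satAll I (longWalkTGDs (m + 1)) ↔
      (∀ x y, (0, [x, y]) ∈ I → (2, [x, y]) ∈ I) ∧
      (∀ x y, (m + 2, [x, y]) ∈ I → (1, []) ∈ I) ∧
      ∀ j < m, ∀ x y z, (j + 2, [x, y]) ∈ I → (j + 2, [y, z]) ∈ I → (j + 3, [x, z]) ∈ I := by
  simp only [satAll, longWalkTGDs, List.forall_mem_cons, List.forall_mem_map, List.mem_range,
    satTGD_copyRule, satTGD_compRule, satTGD_goalRule_pair, Nat.add_sub_cancel]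

lemma satAll_closedWalkTGDs {I : Inst} {m : ℕ} :
    satAll I (closedWalkTGDs (m + 1)) ↔
      (∀ x y, (0, [x, y]) ∈ I → (2, [x, y]) ∈ I) ∧
      (∀ x, (m + 2, [x, x]) ∈ I → (1, []) ∈ I) ∧
      (∀ j < m, ∀ x y z, (j + 2, [x, y]) ∈ I → (j + 2, [y, z]) ∈ I → (j + 3, [x, z]) ∈ I) ∧
      ∀ j < m, ∀ x y, (j + 2, [x, y]) ∈ I → (j + 3, [x, y]) ∈ I := by
  simp only [satAll, closedWalkTGDs, List.forall_mem_cons, List.forall_mem_append,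
    List.forall_mem_map, List.mem_range, satTGD_copyRule, satTGD_compRule, satTGD_goalRule_diag,
    Nat.add_sub_cancel]

/-- Rank of the predicates along the predicate graph: the goal comes last. -/
def predRank (n p : ℕ) : ℕ := if p = 1 then n + 2 else p

lemma nonRecursive_longWalkTGDs {m : ℕ} : NonRecursive (longWalkTGDs (m + 1)) := by
  refine nonRecursive_of_rank (predRank (m + 1)) ?_
  simp only [longWalkTGDs, List.forall_mem_cons, List.forall_mem_map, List.mem_range, copyRule,
    goalRule, compRule, binAtom, List.mem_nil_iff, predRank]
  grind

lemma nonRecursive_closedWalkTGDs {m : ℕ} : NonRecursive (closedWalkTGDs (m + 1)) := by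
  refine nonRecursive_of_rank (predRank (m + 1)) ?_
  simp only [closedWalkTGDs, List.forall_mem_cons, List.forall_mem_append, List.forall_mem_map,
    List.mem_range, copyRule, goalRule, compRule, binAtom, List.mem_nil_iff, predRank]
  grind

lemma schCount_eq_of_mem_iff {Sg : List TGD} {n : ℕ}
    (h : ∀ x, x ∈ schList Sg ↔ x = (1, 0) ∨ x = (0, 2) ∨ ∃ j < n, x = (j + 2, 2)) :
    schCount Sg = n + 2 := by
  have hset : (schList Sg).toFinset =
      insert (1, 0) (insert (0, 2) ((Finset.range n).image fun j => (j + 2, 2))) := by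
    ext x
    simp [h, eq_comm]
  rw [schCount, ← List.card_toFinset, hset, Finset.card_insert_of_notMem (by simp),
    Finset.card_insert_of_notMem (by simp),
    Finset.card_image_of_injective _ (fun a b hab => by simpa using hab), Finset.card_range]

lemma schCount_longWalkTGDs {m : ℕ} : schCount (longWalkTGDs (m + 1)) = m + 1 + 2 := by
  refine schCount_eq_of_mem_iff fun x => ?_
  simp only [schList, longWalkTGDs, List.flatMap_cons, List.mem_append, List.mem_flatMap,
    List.mem_map, List.mem_range, exists_exists_and_eq_and, copyRule, goalRule, compRule, binAtom]
  simp only [List.mem_cons, List.not_mem_nil, or_false, or_and_right, exists_or, exists_eq_left,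
    List.length_cons, List.length_nil]
  grind

lemma schCount_closedWalkTGDs {m : ℕ} : schCount (closedWalkTGDs (m + 1)) = m + 1 + 2 := by
  refine schCount_eq_of_mem_iff fun x => ?_
  simp only [schList, closedWalkTGDs, List.flatMap_cons, List.flatMap_append, List.mem_append,
    List.mem_flatMap, List.mem_map, List.mem_range, exists_exists_and_eq_and, copyRule, goalRule,
    compRule, binAtom]
  simp only [List.mem_cons, List.not_mem_nil, or_false, or_and_right, exists_or, exists_eq_left,
    List.length_cons, List.length_nil]
  grind

/-! ### Walks -/

/-- There is a walk of length `L` from `x` to `y` along predicate `0`. -/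
def HasWalk (I : Inst) (L : ℕ) (x y : GTerm) : Prop :=
  ∃ f : ℕ → GTerm, f 0 = x ∧ f L = y ∧ ∀ i < L, (0, [f i, f (i + 1)]) ∈ I

lemma HasWalk.single {I : Inst} {x y : GTerm} (h : (0, [x, y]) ∈ I) : HasWalk I 1 x y :=
  ⟨fun i => if i = 0 then x else y, by simp, by simp, by simpa using h⟩

lemma HasWalk.append {I : Inst} {L M : ℕ} {x y z : GTerm} (h : HasWalk I L x y)
    (h' : HasWalk I M y z) : HasWalk I (L + M) x z := by
  obtain ⟨f, hf0, hfL, hf⟩ := h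
  obtain ⟨g, hg0, hgM, hg⟩ := h'
  refine ⟨fun i => if i < L then f i else g (i - L), ?_, by simp [hgM], fun i hi => ?_⟩
  · rcases Nat.eq_zero_or_pos L with rfl | hL
    · simp_all
    · simp [hL, hf0]
  · rcases lt_trichotomy (i + 1) L with h | h | h
    · simpa [h, Nat.lt_of_succ_lt h] using hf i (by omega)
    · have hi' : i < L := by omega
      simpa [hi', h, hg0, hfL] using hf i hi'
    · have h1 : ¬ i < L := by omega
      have h2 : ¬ i + 1 < L := by omega
      have h3 : i + 1 - L = i - L + 1 := by omega
      simpa [h1, h2, h3] using hg (i - L) (by omega)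

lemma goal_mem_of_hasWalk {J : Inst} {m : ℕ} (hJ : satAll J (longWalkTGDs (m + 1)))
    {x y : GTerm} (h : HasWalk J (2 ^ m) x y) : (1, []) ∈ J := by
  obtain ⟨hE, hG, hC⟩ := satAll_longWalkTGDs.1 hJ
  obtain ⟨f, -, -, hf⟩ := h
  have key : ∀ j ≤ m, ∀ a, a + 2 ^ j ≤ 2 ^ m → (j + 2, [f a, f (a + 2 ^ j)]) ∈ J := by
    intro j
    induction j with
    | zero => exact fun _ a ha => hE _ _ (hf a (by simpa using ha))
    | succ j ih =>
      intro hj a ha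
      rw [pow_succ, mul_two, ← add_assoc] at ha ⊢
      exact hC j hj _ _ _ (ih (by omega) a (le_trans (Nat.le_add_right _ _) ha)) (ih (by omega) _ ha)
  exact hG _ _ (key m le_rfl 0 (by simp))

lemma goal_mem_of_closed_subwalk {J : Inst} {m N a L : ℕ}
    (hJ : satAll J (closedWalkTGDs (m + 1))) {f : ℕ → GTerm}
    (hf : ∀ i < N, (0, [f i, f (i + 1)]) ∈ J) (hL : 0 < L) (hLm : L ≤ 2 ^ m) (ha : a + L ≤ N)
    (hclosed : f a = f (a + L)) : (1, []) ∈ J := by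
  obtain ⟨hE, hG, hC, hI⟩ := satAll_closedWalkTGDs.1 hJ
  have key : ∀ j ≤ m, ∀ a L, 0 < L → L ≤ 2 ^ j → a + L ≤ N →
      (j + 2, [f a, f (a + L)]) ∈ J := by
    intro j
    induction j with
    | zero =>
      intro _ a L hL hL1 ha
      obtain rfl : L = 1 := by rw [pow_zero] at hL1; omega
      exact hE _ _ (hf a (by omega))
    | succ j ih =>
      intro hj a L hL hL1 ha
      rcases le_or_gt L (2 ^ j) with hle | hgt
      · exact hI j hj _ _ (ih (by omega) a L hL hle ha)
      · rw [pow_succ] at hL1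
        have h1 := ih (by omega) a (2 ^ j) (by positivity) le_rfl (by omega)
        have h2 := ih (by omega) (a + 2 ^ j) (L - 2 ^ j) (by omega) (by omega) (by omega)
        rw [add_assoc, Nat.add_sub_cancel' hgt.le] at h2
        exact hC j hj _ _ _ h1 h2
  exact hG (f a) (by simpa [← hclosed] using key m le_rfl a L hL hLm ha)

lemma le_card_of_injOn_walk {D : Database} {N : ℕ} {f : ℕ → GTerm}
    (hf : ∀ i < N, (0, [f i, f (i + 1)]) ∈ dbInst D) (hinj : ∀ i j, i < j → j < N → f i ≠ f j) :
    N ≤ D.toFinset.card := by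
  classical
  calc N = ((Finset.range N).image fun i => ((0, [f i, f (i + 1)]) : RAtom GTerm)).card := by
        rw [Finset.card_image_of_injOn, Finset.card_range]
        intro i hi j hj hij
        simp only [Finset.coe_range, Set.mem_Iio] at hi hj
        have hfij : f i = f j := by simpa using congrArg (fun a => a.2.head?) hij
        rcases lt_trichotomy i j with h | h | h
        · exact absurd hfij (hinj i j h hj)
        · exact h
        · exact absurd hfij.symm (hinj j i h hi)
    _ ≤ (D.toFinset.image factAtom).card := by
        refine Finset.card_le_card fun a ha => ?_
        obtain ⟨i, hi, rfl⟩ := Finset.mem_image.1 ha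
        obtain ⟨d, hd, hda⟩ := hf i (Finset.mem_range.1 hi)
        exact Finset.mem_image.2 ⟨d, List.mem_toFinset.2 hd, hda⟩
    _ ≤ D.toFinset.card := Finset.card_image_le

lemma fst_eq_zero_of_mem_dbInst {D : Database} (hD : DBover [(0, 2)] D) {a : RAtom GTerm}
    (ha : a ∈ dbInst D) : a.1 = 0 := by
  obtain ⟨d, hd, rfl⟩ := ha
  have := hD d hd
  simp only [atomOverSig, List.mem_singleton, Prod.mk.injEq] at this
  exact this.1

lemma hasWalk_of_mem_omqEval {D : Database} {m : ℕ} (hD : DBover [(0, 2)] D) {c : List ℕ}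
    (hc : c ∈ omqEval ([(0, 2)], longWalkTGDs (m + 1), goalQuery) D) :
    c = [] ∧ ∃ x y, HasWalk (dbInst D) (2 ^ m) x y := by
  let J : Inst := dbInst D ∪
    ({a | ∃ j x y, a = (j + 2, [x, y]) ∧ HasWalk (dbInst D) (2 ^ j) x y} ∪
      {a | a = (1, []) ∧ ∃ x y, HasWalk (dbInst D) (2 ^ m) x y})
  have hzero : ∀ x y, (0, [x, y]) ∈ J → (0, [x, y]) ∈ dbInst D := by
    rintro x y (h | ⟨j, x', y', h, -⟩ | ⟨h, -⟩)
    · exact h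
    · simp at h
    · simp at h
  have hwalk : ∀ j x y, (j + 2, [x, y]) ∈ J → HasWalk (dbInst D) (2 ^ j) x y := by
    rintro j x y (h | ⟨j', x', y', h, hw⟩ | ⟨h, -⟩)
    · exact absurd (fst_eq_zero_of_mem_dbInst hD h) (by simp)
    · simp only [Prod.mk.injEq, Nat.add_right_cancel_iff, List.cons.injEq, and_true] at h
      obtain ⟨rfl, rfl, rfl⟩ := h
      exact hw
    · simp at h
  have hJ : satAll J (longWalkTGDs (m + 1)) := by
    refine satAll_longWalkTGDs.2 ⟨fun x y h => ?_, fun x y h => ?_, fun j _ x y z h h' => ?_⟩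
    · exact Or.inr (Or.inl ⟨0, x, y, rfl, by simpa using HasWalk.single (hzero x y h)⟩)
    · exact Or.inr (Or.inr ⟨rfl, x, y, hwalk m x y h⟩)
    · refine Or.inr (Or.inl ⟨j + 1, x, z, rfl, ?_⟩)
      rw [pow_succ, mul_two]
      exact (hwalk j x y h).append (hwalk j y z h')
  obtain ⟨hgoal, hnil⟩ := mem_evalCQ_goalQuery.1 (hc J Set.subset_union_left hJ)
  refine ⟨hnil, ?_⟩
  rcases hgoal with h | ⟨j, x, y, h, -⟩ | ⟨-, h⟩
  · exact absurd (fst_eq_zero_of_mem_dbInst hD h) (by simp)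
  · simp at h
  · exact h

lemma two_pow_le_card_of_not_subset {D : Database} {m : ℕ} (hD : DBover [(0, 2)] D)
    (h : ¬ (omqEval ([(0, 2)], longWalkTGDs (m + 1), goalQuery) D ⊆
      omqEval ([(0, 2)], closedWalkTGDs (m + 1), goalQuery) D)) :
    2 ^ m ≤ D.toFinset.card := by
  obtain ⟨c, hc1, hc2⟩ := Set.not_subset.1 h
  obtain ⟨rfl, x, y, f, -, -, hf⟩ := hasWalk_of_mem_omqEval hD hc1
  refine le_card_of_injOn_walk hf fun i j hij hj heq => hc2 fun J hDJ hJ => ?_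
  refine mem_evalCQ_goalQuery.2 ⟨?_, rfl⟩
  exact goal_mem_of_closed_subwalk (a := i) (L := j - i) hJ (fun i hi => hDJ (hf i hi))
    (by omega) (by omega) (by omega) (by rwa [Nat.add_sub_cancel' hij.le])

/-! ### Non-containment -/

/-- The directed path `0 → 1 → ⋯ → N`. -/
def pathDB (N : ℕ) : Database := (List.range N).map fun i => (0, [i, i + 1])

lemma dbOver_pathDB {N : ℕ} : DBover [(0, 2)] (pathDB N) := by
  simp [DBover, pathDB, atomOverSig]

lemma nil_mem_omqEval_longWalk_pathDB {m : ℕ} :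
    [] ∈ omqEval ([(0, 2)], longWalkTGDs (m + 1), goalQuery) (pathDB (2 ^ m)) := by
  intro J hDJ hJ
  refine mem_evalCQ_goalQuery.2 ⟨goal_mem_of_hasWalk hJ ⟨Sum.inl, rfl, rfl, fun i hi => ?_⟩, rfl⟩
  exact hDJ ⟨(0, [i, i + 1]), List.mem_map.2 ⟨i, List.mem_range.2 hi, rfl⟩, rfl⟩

lemma nil_notMem_omqEval_closedWalk_pathDB {m N : ℕ} :
    [] ∉ omqEval ([(0, 2)], closedWalkTGDs (m + 1), goalQuery) (pathDB N) := by
  intro h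
  let J : Inst := {a | ∃ p x y, a = (p, [Sum.inl x, Sum.inl y]) ∧ x < y}
  have hJ : satAll J (closedWalkTGDs (m + 1)) := by
    refine satAll_closedWalkTGDs.2 ⟨?_, ?_, ?_, ?_⟩
    · rintro x y ⟨p, a, b, hab, hlt⟩
      exact ⟨2, a, b, by simp_all, hlt⟩
    · rintro x ⟨p, a, b, hab, hlt⟩
      simp only [Prod.mk.injEq, List.cons.injEq, and_true] at hab
      obtain ⟨-, rfl, hab⟩ := hab
      exact absurd (Sum.inl_injective hab) hlt.ne
    · rintro j - x y z ⟨p, a, b, hab, hlt⟩ ⟨p', b', c, hbc, hlt'⟩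
      simp only [Prod.mk.injEq, List.cons.injEq, and_true] at hab hbc
      obtain ⟨-, rfl, rfl⟩ := hab
      obtain ⟨-, hb, rfl⟩ := hbc
      obtain rfl := Sum.inl_injective hb
      exact ⟨j + 3, a, c, rfl, hlt.trans hlt'⟩
    · rintro j - x y ⟨p, a, b, hab, hlt⟩
      exact ⟨j + 3, a, b, by simp_all, hlt⟩
  have hDJ : dbInst (pathDB N) ⊆ J := by
    rintro _ ⟨d, hd, rfl⟩
    obtain ⟨i, -, rfl⟩ := List.mem_map.1 hd
    exact ⟨0, i, i + 1, rfl, Nat.lt_succ_self i⟩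
  obtain ⟨⟨p, x, y, hgoal, -⟩, -⟩ := mem_evalCQ_goalQuery.1 (h J hDJ hJ)
  simp at hgoal

/-- The two families have the required size, every witness to non-containment is exponentially
large, and such witnesses exist. -/
lemma exponential_witness_families (n : ℕ) (hn : 0 < n) :
    (NonRecursive (longWalkTGDs n) ∧ NonRecursive (closedWalkTGDs n) ∧
      schCount (longWalkTGDs n) = n + 2 ∧ schCount (closedWalkTGDs n) = n + 2 ∧
      ∀ D : Database, DBover [(0, 2)] D →
        ¬ (omqEval ([(0, 2)], longWalkTGDs n, goalQuery) D ⊆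
          omqEval ([(0, 2)], closedWalkTGDs n, goalQuery) D) →
        2 ^ (n - 1) ≤ D.toFinset.card) ∧
      ¬ omqContained ([(0, 2)], longWalkTGDs n, goalQuery)
        ([(0, 2)], closedWalkTGDs n, goalQuery) := by
  obtain ⟨m, rfl⟩ := Nat.exists_eq_add_of_lt hn
  rw [zero_add]
  exact ⟨⟨nonRecursive_longWalkTGDs, nonRecursive_closedWalkTGDs, schCount_longWalkTGDs,
    schCount_closedWalkTGDs, fun D hD h => two_pow_le_card_of_not_subset hD h⟩,
    fun h => nil_notMem_omqEval_closedWalk_pathDB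
      (h (pathDB (2 ^ m)) dbOver_pathDB nil_mem_omqEval_longWalk_pathDB)⟩

/-- exponential witnesses for non-recursive OMQs are needed.
There are families `{Q_1^n = (S, Σ_1^n, q_1)}` and `{Q_2^n = (S, Σ_2^n, q_2)}`
of OMQs from `(NR, CQ)` over a common data schema `S`, with
`|sch(Σ_1^n)| = |sch(Σ_2^n)| = n + 2`, such that for all `n > 0` and every
`S`-database `D`: if `Q_1^n(D) ⊄ Q_2^n(D)` then `|D| ≥ 2^{n-1}`. -/
theorem statement_9 :
    ∃ (S : RSig) (Sg1 Sg2 : ℕ → List TGD) (q1 q2 : CQ),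
      ∀ n : ℕ, 0 < n →
        NonRecursive (Sg1 n) ∧ NonRecursive (Sg2 n) ∧
        schCount (Sg1 n) = n + 2 ∧ schCount (Sg2 n) = n + 2 ∧
        ∀ D : Database, DBover S D →
          ¬ (omqEval (S, Sg1 n, q1) D ⊆ omqEval (S, Sg2 n, q2) D) →
          2 ^ (n - 1) ≤ D.toFinset.card := by
  exact ⟨[(0, 2)], longWalkTGDs, closedWalkTGDs, goalQuery, goalQuery,
    fun n hn => (exponential_witness_families n hn).1⟩
end

section
/- Let Q = (S, Σ, q) be an OMQ from (G, BCQ), i.e., Σ is a finite set of guarded, constant-free, single-head tgds and q a Boolean CQ, and let D be an S-database with D ⊨ Q (i.e., Q(D) ≠ ∅). Then there exists a finite S-instance Î such that Î ⊨ Q and: (1) Î is a C-tree with |adom(C)| ≤ ar(S ∪ sch(Σ)) · |q|, where ar denotes maximum arity and |q| the number of atoms of q; and (2) there is a homomorphism from Î to D. -/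
/-- A tree decomposition of an instance `I`, with trees modeled as prefix-closed
sets of finite sequences of naturals (root `[]`); the connectivity and coverage
conditions for single elements are required only for elements outside `omitted`
(a tree decomposition "omitting" that set). -/
structure TreeDecomp {α : Type} (I : GInst α) (omitted : Set α) where
  nodes : Set (List ℕ)
  bags : List ℕ → Set α
  root_mem : ([] : List ℕ) ∈ nodes
  prefix_closed : ∀ x ∈ nodes, ∀ y : List ℕ, y <+: x → y ∈ nodes
  bags_cover : ∀ a ∈ I, ∃ t ∈ nodes, ∀ s ∈ a.2, s ∈ bags t
  elem_mem : ∀ v ∈ instAdom I, v ∉ omitted → ∃ t ∈ nodes, v ∈ bags t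
  connected : ∀ v, v ∉ omitted → ∀ t1 ∈ nodes, ∀ t2 ∈ nodes, ∀ z ∈ nodes,
    v ∈ bags t1 → v ∈ bags t2 → (z <+: t1 ∨ z <+: t2) →
    (∀ w : List ℕ, w <+: t1 → w <+: t2 → w <+: z) → v ∈ bags z

/-- A tree decomposition is guarded except for the nodes in `N`: every bag of a
node outside `N` is contained in the argument set of some atom of the instance. -/
def guardedExcept {α : Type} {I : GInst α} {V : Set α}
    (δ : TreeDecomp I V) (N : Set (List ℕ)) : Prop :=
  ∀ t ∈ δ.nodes, t ∉ N → ∃ a ∈ I, ∀ s ∈ δ.bags t, s ∈ a.2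

/-- The subinstance of `I` induced by a set `X` of domain elements. -/
def inducedSub {α : Type} (I : GInst α) (X : Set α) : GInst α :=
  {a ∈ I | ∀ s ∈ a.2, s ∈ X}

/-- `I` is a `C`-tree: it has a tree decomposition whose root bag induces exactly
`C` and which is guarded except for the root. -/
def IsCTree {α : Type} (I : GInst α) (C : GInst α) : Prop :=
  C ⊆ I ∧ ∃ δ : TreeDecomp I (∅ : Set α),
    inducedSub I (δ.bags []) = C ∧ guardedExcept δ {([] : List ℕ)}

/-- A tgd with a single head atom. -/
def SingleHead (τ : TGD) : Prop := τ.2.length = 1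

def atomsConstFree (as : List (RAtom QTerm)) : Prop :=
  ∀ a ∈ as, ∀ c : ℕ, (Sum.inl c : QTerm) ∉ a.2

/-- A constant-free tgd. -/
def TGDConstFree (τ : TGD) : Prop := atomsConstFree τ.1 ∧ atomsConstFree τ.2

/-- A constant-free CQ. -/
def CQConstFree (q : CQ) : Prop := atomsConstFree q.2

/-- Maximum arity over the predicates of a schema. -/
def arMax (S : RSig) : ℕ := (S.map Prod.snd).foldr max 0

/-- Homomorphism between instances: identity on constants, mapping atoms to atoms. -/
def IsHomI (h : GTerm → GTerm) (I J : Inst) : Prop :=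
  (∀ c : ℕ, h (Sum.inl c) = Sum.inl c) ∧ ∀ a ∈ I, (a.1, a.2.map h) ∈ J

/-! ### A Skolem chase with stored origins -/

/-- The arguments of the `n`-th fact of `D`. -/
def factArgs (D : Database) (n : ℕ) : List ℕ := (D.getD n (0, [])).2

/-- The content of a Skolem null: its origin, the tgd and variable that created it, and the
values of the body arguments. -/
abbrev SkolemCode : Type := ℕ × TGD × ℕ × List GTerm

def skolemNull (n : ℕ) (τ : TGD) (z : ℕ) (l : List GTerm) : GTerm :=
  Sum.inr (Encodable.encode ((n, τ, z, l) : SkolemCode))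

def skolemDecode (m : ℕ) : SkolemCode := Denumerable.ofNat SkolemCode m

lemma skolemDecode_encode (s : SkolemCode) : skolemDecode (Encodable.encode s) = s :=
  Denumerable.ofNat_encode s

/-- A term is local to the `n`-th fact if it is one of its constants or a null of origin `n`. -/
def LocalTo (D : Database) (n : ℕ) : GTerm → Prop
  | Sum.inl c => c ∈ factArgs D n
  | Sum.inr m => (skolemDecode m).1 = n

/-- The values of all argument positions of the body of `τ`. -/
def bodyVals (τ : TGD) (ν : Assign) : List GTerm := (τ.1.flatMap Prod.snd).map (applyT ν)

open Classical in
noncomputable def skolemExt (n : ℕ) (τ : TGD) (σ : Assign) : Assign := fun v =>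
  if v ∈ varsOf τ.1 then σ v else skolemNull n τ v (bodyVals τ σ)

/-- The atoms of the Skolem chase derivable in at most `k` rounds. -/
inductive ChaseStage (D : Database) (Sg : List TGD) : ℕ → RAtom GTerm → Prop
  | base (k : ℕ) (f : DBFact) (hf : f ∈ D) : ChaseStage D Sg k (factAtom f)
  | step (k : ℕ) (τ : TGD) (hτ : τ ∈ Sg) (σ : Assign)
      (hb : ∀ a ∈ τ.1, ChaseStage D Sg k (applyA σ a))
      (n : ℕ) (hn : n < D.length)
      (hl : ∀ a ∈ τ.1, ∀ x ∈ a.2, LocalTo D n (applyT σ x))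
      (h : RAtom QTerm) (hh : h ∈ τ.2) :
      ChaseStage D Sg (k + 1) (applyA (skolemExt n τ σ) h)

lemma ChaseStage.succ {D : Database} {Sg : List TGD} {k : ℕ} {a : RAtom GTerm}
    (h : ChaseStage D Sg k a) : ChaseStage D Sg (k + 1) a := by
  induction h with
  | base k f hf => exact .base _ f hf
  | step k τ hτ σ hb n hn hl h hh ih => exact .step _ τ hτ σ ih n hn hl h hh

lemma ChaseStage.mono {D : Database} {Sg : List TGD} {k l : ℕ} {a : RAtom GTerm}
    (h : ChaseStage D Sg k a) (hkl : k ≤ l) : ChaseStage D Sg l a := by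
  induction hkl with
  | refl => exact h
  | step _ ih => exact ih.succ

lemma ChaseStage.exists_common {D : Database} {Sg : List TGD} {T : Type} (as : List T)
    (f : T → RAtom GTerm) (h : ∀ a ∈ as, ∃ k, ChaseStage D Sg k (f a)) :
    ∃ k, ∀ a ∈ as, ChaseStage D Sg k (f a) := by
  induction as with
  | nil => exact ⟨0, by simp⟩
  | cons a as ih =>
    obtain ⟨k, hk⟩ := ih fun b hb => h b (List.mem_cons_of_mem _ hb)
    obtain ⟨l, hl⟩ := h a List.mem_cons_self
    refine ⟨max k l, fun b hb => ?_⟩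
    rcases List.mem_cons.1 hb with rfl | hb
    · exact hl.mono (le_max_right _ _)
    · exact (hk b hb).mono (le_max_left _ _)

lemma exists_var_of_constFree {as : List (RAtom QTerm)} (h : atomsConstFree as)
    {a : RAtom QTerm} (ha : a ∈ as) {x : QTerm} (hx : x ∈ a.2) : ∃ v, x = Sum.inr v := by
  rcases x with c | v
  · exact absurd hx (h a ha c)
  · exact ⟨v, rfl⟩

lemma exists_factArgs {D : Database} {f : DBFact} (hf : f ∈ D) :
    ∃ n < D.length, factArgs D n = f.2 := by
  obtain ⟨n, hn, rfl⟩ := List.getElem_of_mem hf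
  exact ⟨n, hn, by simp [factArgs, hn]⟩

lemma localTo_skolemNull (D : Database) (n : ℕ) (τ : TGD) (z : ℕ) (l : List GTerm) :
    LocalTo D n (skolemNull n τ z l) := by
  rw [skolemNull, LocalTo, skolemDecode_encode]

/-- The terms of a head atom are local wherever the body match is. -/
lemma localTo_of_mem_head {D : Database} {n : ℕ} {τ : TGD} {σ : Assign}
    (hcf : TGDConstFree τ) (hl : ∀ a ∈ τ.1, ∀ x ∈ a.2, LocalTo D n (applyT σ x))
    {h : RAtom QTerm} (hh : h ∈ τ.2) {x : GTerm} (hx : x ∈ (applyA (skolemExt n τ σ) h).2) :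
    LocalTo D n x := by
  obtain ⟨y, hy, rfl⟩ := List.mem_map.1 hx
  obtain ⟨v, rfl⟩ := exists_var_of_constFree hcf.2 hh hy
  by_cases hv : v ∈ varsOf τ.1
  · obtain ⟨b, hb, hvb⟩ := id hv
    simpa [applyT, skolemExt, hv] using hl b hb _ hvb
  · simpa [applyT, skolemExt, hv] using localTo_skolemNull D n τ v (bodyVals τ σ)

/-- Every chase atom is local to some database fact. -/
lemma ChaseStage.exists_local {D : Database} {Sg : List TGD} (hcf : ∀ τ ∈ Sg, TGDConstFree τ)
    {k : ℕ} {a : RAtom GTerm} (h : ChaseStage D Sg k a) :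
    ∃ n < D.length, ∀ x ∈ a.2, LocalTo D n x := by
  cases h with
  | base k f hf =>
    obtain ⟨n, hn, hargs⟩ := exists_factArgs hf
    refine ⟨n, hn, fun x hx => ?_⟩
    obtain ⟨c, hc, rfl⟩ := List.mem_map.1 hx
    simpa [LocalTo, hargs] using hc
  | step k τ hτ σ hb n hn hl h hh =>
    exact ⟨n, hn, fun x hx => localTo_of_mem_head (hcf τ hτ) hl hh hx⟩

lemma satAll_chase {D : Database} {Sg : List TGD}
    (hG : ∀ τ ∈ Sg, GuardedTGD τ) (hcf : ∀ τ ∈ Sg, TGDConstFree τ) :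
    satAll {a | ∃ k, ChaseStage D Sg k a} Sg := by
  intro τ hτ ν hν
  obtain ⟨k, hk⟩ := ChaseStage.exists_common τ.1 (applyA ν) hν
  obtain ⟨g, hg, hgv⟩ := hG τ hτ
  obtain ⟨n, hn, hl⟩ := (hk g hg).exists_local hcf
  refine ⟨skolemExt n τ ν, fun v hv => by simp [skolemExt, hv], fun h hh => ⟨k + 1, ?_⟩⟩
  refine .step k τ hτ ν hk n hn (fun a ha x hx => ?_) h hh
  obtain ⟨v, rfl⟩ := exists_var_of_constFree (hcf τ hτ).1 ha hx
  exact hl _ (List.mem_map_of_mem (hgv v ⟨a, ha, hx⟩))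

/-! ### Evaluating Skolem terms in a model -/

open Classical in
/-- A Skolem function of `J`: extends a body match, given by its values, to the head. -/
noncomputable def skolemFun (J : Inst) (τ : TGD) (l : List GTerm) : Assign :=
  if h : ∃ ν' ν : Assign, bodyVals τ ν = l ∧ (∀ v ∈ varsOf τ.1, ν' v = ν v) ∧
      ∀ a ∈ τ.2, applyA ν' a ∈ J then h.choose else fun _ => Sum.inl 0

lemma bodyVals_inj {τ : TGD} {ν μ : Assign} (h : bodyVals τ ν = bodyVals τ μ) :
    ∀ v ∈ varsOf τ.1, ν v = μ v := by
  rintro v ⟨a, ha, hv⟩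
  have := List.map_inj_left.1 h (Sum.inr v) (List.mem_flatMap.2 ⟨a, ha, hv⟩)
  simpa [applyT] using this

lemma skolemFun_spec {J : Inst} {τ : TGD} (hJ : satTGD J τ) {ν : Assign}
    (hν : ∀ a ∈ τ.1, applyA ν a ∈ J) :
    (∀ v ∈ varsOf τ.1, skolemFun J τ (bodyVals τ ν) v = ν v) ∧
      ∀ a ∈ τ.2, applyA (skolemFun J τ (bodyVals τ ν)) a ∈ J := by
  obtain ⟨ν', h1, h2⟩ := hJ ν hν
  have hex : ∃ ν' μ : Assign, bodyVals τ μ = bodyVals τ ν ∧ (∀ v ∈ varsOf τ.1, ν' v = μ v) ∧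
      ∀ a ∈ τ.2, applyA ν' a ∈ J := ⟨ν', ν, rfl, h1, h2⟩
  have heq : skolemFun J τ (bodyVals τ ν) = hex.choose := dif_pos hex
  obtain ⟨μ, hμ, h3, h4⟩ := hex.choose_spec
  rw [heq]
  exact ⟨fun v hv => (h3 v hv).trans (bodyVals_inj hμ v hv), h4⟩

lemma encode_lt_encode_of_mem {α : Type} [Encodable α] {x : α} {l : List α} (h : x ∈ l) :
    Encodable.encode x < Encodable.encode l := by
  induction l with
  | nil => simp at h
  | cons a l ih =>
    rw [Encodable.encode_list_cons]
    rcases List.mem_cons.1 h with rfl | h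
    · exact Nat.lt_succ_of_le (Nat.left_le_pair _ _)
    · exact Nat.lt_succ_of_le ((ih h).le.trans (Nat.right_le_pair _ _))

lemma encode_lt_of_mem_skolemDecode {m : ℕ} {x : GTerm} (h : x ∈ (skolemDecode m).2.2.2) :
    Encodable.encode x < m := by
  have hm : Encodable.encode (skolemDecode m) = m := Denumerable.encode_ofNat m
  revert h hm
  generalize skolemDecode m = s
  obtain ⟨n, τ, z, l⟩ := s
  intro h hm
  rw [Encodable.encode_prod_val, Encodable.encode_prod_val, Encodable.encode_prod_val] at hm
  rw [← hm]
  exact (encode_lt_encode_of_mem h).trans_le ((Nat.right_le_pair _ _).trans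
    ((Nat.right_le_pair _ _).trans (Nat.right_le_pair _ _)))

/-- The value in `J` of a Skolem term, given an interpretation `ρ` of the constants. -/
noncomputable def skolemEval (J : Inst) (ρ : ℕ → GTerm) : GTerm → GTerm
  | Sum.inl c => ρ c
  | Sum.inr m => skolemFun J (skolemDecode m).2.1
      ((skolemDecode m).2.2.2.attach.map fun x => skolemEval J ρ x.1) (skolemDecode m).2.2.1
termination_by t => Encodable.encode t
decreasing_by
  have := encode_lt_of_mem_skolemDecode x.2
  simp only [Encodable.encode_inr, Encodable.encode_nat]
  omega

lemma skolemEval_inl (J : Inst) (ρ : ℕ → GTerm) (c : ℕ) : skolemEval J ρ (Sum.inl c) = ρ c := by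
  rw [skolemEval]

lemma skolemEval_skolemNull (J : Inst) (ρ : ℕ → GTerm) (n : ℕ) (τ : TGD) (z : ℕ)
    (l : List GTerm) :
    skolemEval J ρ (skolemNull n τ z l) = skolemFun J τ (l.map (skolemEval J ρ)) z := by
  rw [skolemNull, skolemEval, skolemDecode_encode]
  exact congrArg (fun l => skolemFun J τ l z) List.attach_map_val

/-- Soundness of one chase step under evaluation. -/
lemma skolemEval_step {J : Inst} {τ : TGD} (hJ : satTGD J τ) (hcf : TGDConstFree τ)
    (ρ : ℕ → GTerm) (n : ℕ) (σ : Assign)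
    (hb : ∀ a ∈ τ.1, ((applyA σ a).1, (applyA σ a).2.map (skolemEval J ρ)) ∈ J)
    {h : RAtom QTerm} (hh : h ∈ τ.2) :
    ((applyA (skolemExt n τ σ) h).1,
      (applyA (skolemExt n τ σ) h).2.map (skolemEval J ρ)) ∈ J := by
  set ν : Assign := fun v => skolemEval J ρ (σ v)
  have hν : ∀ a ∈ τ.1, applyA ν a ∈ J := by
    intro a ha
    have hE : applyA ν a = ((applyA σ a).1, (applyA σ a).2.map (skolemEval J ρ)) := by
      refine Prod.ext rfl ?_
      simp only [applyA, List.map_map]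
      refine List.map_congr_left fun x hx => ?_
      obtain ⟨v, rfl⟩ := exists_var_of_constFree hcf.1 ha hx
      rfl
    exact hE ▸ hb a ha
  have hvals : bodyVals τ ν = (bodyVals τ σ).map (skolemEval J ρ) := by
    simp only [bodyVals, List.map_map]
    refine List.map_congr_left fun x hx => ?_
    obtain ⟨a, ha, hx⟩ := List.mem_flatMap.1 hx
    obtain ⟨v, rfl⟩ := exists_var_of_constFree hcf.1 ha hx
    rfl
  obtain ⟨h1, h2⟩ := skolemFun_spec hJ hν
  convert h2 h hh using 1
  refine Prod.ext rfl ?_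
  simp only [applyA, List.map_map]
  refine List.map_congr_left fun x hx => ?_
  obtain ⟨v, rfl⟩ := exists_var_of_constFree hcf.2 hh hx
  by_cases hv : v ∈ varsOf τ.1
  · simp [applyT, skolemExt, hv, h1 v hv, ν]
  · simp [applyT, skolemExt, hv, skolemEval_skolemNull, hvals]

/-! ### The unravelling

Nodes are handled as reversed paths: `n :: r` is the child of `r` carrying the `n`-th fact. -/

/-- The constants at a node; `A` is the content of the root. -/
def unravelBag (D : Database) (A : List ℕ) : List ℕ → List ℕ
  | [] => A
  | n :: _ => factArgs D n

/-- The node in which the copy of `c` visible at a given node was introduced. -/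
def copyNode (D : Database) (A : List ℕ) : List ℕ → ℕ → List ℕ
  | [], _ => []
  | n :: r, c => if c ∈ unravelBag D A r then copyNode D A r c else n :: r

/-- The copy of the constant `c` at a node. -/
def unravelCopy (D : Database) (A : List ℕ) (r : List ℕ) (c : ℕ) : GTerm :=
  Sum.inr (Encodable.encode (copyNode D A r c, c))

/-- The nodes of depth at most `N`. -/
def unravelNodes (D : Database) (N : ℕ) : Set (List ℕ) :=
  {r | r.length ≤ N ∧ ∀ n ∈ r, n < D.length}

/-- The unravelling of `D` up to depth `N`, with root content `A`. -/
def unravel (D : Database) (A : List ℕ) (N : ℕ) : Inst :=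
  {a | ∃ r ∈ unravelNodes D N, ∃ f ∈ D, (∀ c ∈ f.2, c ∈ unravelBag D A r) ∧
    a = (f.1, f.2.map (unravelCopy D A r))}

/-- The map sending every copy back to the constant it copies. -/
def unravelProj : GTerm → GTerm
  | Sum.inl c => Sum.inl c
  | Sum.inr m => Sum.inl (Denumerable.ofNat (List ℕ × ℕ) m).2

lemma unravelCopy_inj {D : Database} {A r s : List ℕ} {c d : ℕ} :
    unravelCopy D A r c = unravelCopy D A s d ↔
      copyNode D A r c = copyNode D A s d ∧ c = d := by
  simp [unravelCopy]

lemma unravelCopy_cons {D : Database} {A r : List ℕ} {n c : ℕ} (hc : c ∈ unravelBag D A r) :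
    unravelCopy D A (n :: r) c = unravelCopy D A r c := by
  simp [unravelCopy, copyNode, hc]

lemma copyNode_suffix (D : Database) (A r : List ℕ) (c : ℕ) : copyNode D A r c <:+ r := by
  induction r with
  | nil => exact List.suffix_refl _
  | cons n r ih =>
    rw [copyNode]
    split_ifs
    · exact ih.trans (List.suffix_cons n r)
    · exact List.suffix_refl _

/-- A copy is visible at all nodes between its introduction and any node showing it. -/
lemma copyNode_between {D : Database} {A r z : List ℕ} {c : ℕ} (hc : c ∈ unravelBag D A r)
    (hz : z <:+ r) (he : copyNode D A r c <:+ z) :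
    c ∈ unravelBag D A z ∧ copyNode D A z c = copyNode D A r c := by
  induction r with
  | nil =>
    obtain rfl := List.suffix_nil.1 hz
    exact ⟨hc, rfl⟩
  | cons n r ih =>
    rcases List.suffix_cons_iff.1 hz with rfl | hz'
    · exact ⟨hc, rfl⟩
    · by_cases hr : c ∈ unravelBag D A r
      · have hE : copyNode D A (n :: r) c = copyNode D A r c := by simp [copyNode, hr]
        rw [hE] at he ⊢
        exact ih hr hz' he
      · have hE : copyNode D A (n :: r) c = n :: r := by simp [copyNode, hr]
        rw [hE] at he
        have h1 := he.length_le
        have h2 := hz'.length_le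
        simp only [List.length_cons] at h1
        omega

lemma unravelNodes_finite (D : Database) (N : ℕ) : (unravelNodes D N).Finite := by
  refine ((List.finite_length_le (Fin D.length) N).image (List.map Fin.val)).subset ?_
  rintro r ⟨hr, hlt⟩
  lift r to List (Fin D.length) using hlt
  exact ⟨r, by simpa using hr, rfl⟩

lemma unravel_finite (D : Database) (A : List ℕ) (N : ℕ) : (unravel D A N).Finite := by
  refine (((unravelNodes_finite D N).prod (List.finite_toSet D)).image
    fun p => (p.2.1, p.2.2.map (unravelCopy D A p.1))).subset ?_
  rintro a ⟨r, hr, f, hf, -, rfl⟩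
  exact ⟨(r, f), ⟨hr, hf⟩, rfl⟩

lemma instOver_unravel {S : RSig} {D : Database} (hD : DBover S D) (A : List ℕ) (N : ℕ) :
    InstOver S (unravel D A N) := by
  rintro a ⟨r, -, f, hf, -, rfl⟩
  simpa [atomOverSig] using hD f hf

lemma isHomI_unravelProj (D : Database) (A : List ℕ) (N : ℕ) :
    IsHomI unravelProj (unravel D A N) (dbInst D) := by
  refine ⟨fun c => rfl, ?_⟩
  rintro a ⟨r, -, f, hf, -, rfl⟩
  refine ⟨f, hf, Prod.ext rfl ?_⟩
  simp only [factAtom, List.map_map]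
  refine List.map_congr_left fun c _ => ?_
  simp only [Function.comp, unravelCopy, unravelProj, Denumerable.ofNat_encode]

/-- The tree decomposition of the unravelling along its nodes. -/
def unravelDecomp (D : Database) (A : List ℕ) (N : ℕ) :
    TreeDecomp (unravel D A N) (∅ : Set GTerm) where
  nodes := {t | t.reverse ∈ unravelNodes D N}
  bags t := {s | ∃ c ∈ unravelBag D A t.reverse, unravelCopy D A t.reverse c = s}
  root_mem := by simp [unravelNodes]
  prefix_closed := by
    rintro x ⟨hx, hlt⟩ y hy
    have hyx := List.reverse_suffix.2 hy
    exact ⟨hyx.length_le.trans hx, fun n hn => hlt n (hyx.subset hn)⟩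
  bags_cover := by
    rintro a ⟨r, hr, f, hf, hfr, rfl⟩
    refine ⟨r.reverse, by simpa using hr, fun s hs => ?_⟩
    obtain ⟨c, hc, rfl⟩ := List.mem_map.1 hs
    exact ⟨c, by simpa using hfr c hc, by simp⟩
  elem_mem := by
    rintro v ⟨a, ⟨r, hr, f, hf, hfr, rfl⟩, hv⟩ -
    obtain ⟨c, hc, rfl⟩ := List.mem_map.1 hv
    exact ⟨r.reverse, by simpa using hr, c, by simpa using hfr c hc, by simp⟩
  connected := by
    rintro v - t1 - t2 - z - ⟨c, hc, rfl⟩ ⟨d, hd, hdc⟩ hz hmeet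
    obtain ⟨he, rfl⟩ := unravelCopy_inj.1 hdc
    have hmem : ∀ t : List ℕ, copyNode D A t.reverse d <:+ t.reverse :=
      fun t => copyNode_suffix _ _ _ _
    have hw : copyNode D A t1.reverse d <:+ z.reverse := by
      have := hmeet (copyNode D A t1.reverse d).reverse
        (List.reverse_suffix.1 (by simpa using hmem t1))
        (List.reverse_suffix.1 (by simpa [he] using hmem t2))
      simpa using List.reverse_suffix.2 this
    rcases hz with hz | hz
    · obtain ⟨h1, h2⟩ := copyNode_between hc (List.reverse_suffix.2 hz) hw
      exact ⟨d, h1, unravelCopy_inj.2 ⟨h2, rfl⟩⟩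
    · obtain ⟨h1, h2⟩ := copyNode_between hd (List.reverse_suffix.2 hz) (he ▸ hw)
      exact ⟨d, h1, unravelCopy_inj.2 ⟨h2.trans he, rfl⟩⟩

lemma guardedExcept_unravelDecomp (D : Database) (A : List ℕ) (N : ℕ) :
    guardedExcept (unravelDecomp D A N) {([] : List ℕ)} := by
  intro t ht htne
  change t.reverse ∈ unravelNodes D N at ht
  change ∃ a ∈ unravel D A N, ∀ s, (∃ c ∈ unravelBag D A t.reverse,
    unravelCopy D A t.reverse c = s) → s ∈ a.2
  have hne : t.reverse ≠ [] := by simpa using htne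
  revert ht hne
  generalize t.reverse = r
  intro hr hne
  obtain ⟨n, r, rfl⟩ := List.exists_cons_of_ne_nil hne
  have hn : n < D.length := hr.2 n List.mem_cons_self
  have hargs : factArgs D n = D[n].2 := by simp [factArgs, hn]
  refine ⟨_, ⟨n :: r, hr, D[n], List.getElem_mem hn, fun c hc => ?_, rfl⟩, ?_⟩
  · simpa [unravelBag, hargs] using hc
  · rintro s ⟨c, hc, rfl⟩
    refine List.mem_map_of_mem ?_
    simpa [unravelBag, hargs] using hc

/-- Chase atoms hold in every model of the unravelling, at every node carrying a fact to which
they are local, provided the unravelling is continued deep enough below that node. -/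
lemma ChaseStage.eval_mem {D : Database} {Sg : List TGD} (hcf : ∀ τ ∈ Sg, TGDConstFree τ)
    {A : List ℕ} {N : ℕ} {J : Inst} (hI : unravel D A N ⊆ J) (hJ : satAll J Sg)
    {k : ℕ} {a : RAtom GTerm} (h : ChaseStage D Sg k a) :
    ∀ n r, (∀ x ∈ a.2, LocalTo D n x) → (∀ m ∈ n :: r, m < D.length) →
      (n :: r).length + k ≤ N →
      (a.1, a.2.map (skolemEval J (unravelCopy D A (n :: r)))) ∈ J := by
  induction h with
  | base k f hf =>
    intro n r hl hr hN
    refine hI ⟨n :: r, ⟨by omega, hr⟩, f, hf, fun c hc => ?_, Prod.ext rfl ?_⟩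
    · simpa [LocalTo, unravelBag] using hl (Sum.inl c) (List.mem_map_of_mem hc)
    · simp only [factAtom, List.map_map]
      exact List.map_congr_left fun c _ => skolemEval_inl _ _ _
  | step k τ hτ σ hb n' hn' hl' h hh ih =>
    intro n r hl hr hN
    have hloc' : ∀ b ∈ τ.1, ∀ x ∈ (applyA σ b).2, LocalTo D n' x := by
      intro b hb x hx
      obtain ⟨y, hy, rfl⟩ := List.mem_map.1 hx
      exact hl' b hb y hy
    by_cases hnn : n' = n
    · subst hnn
      exact skolemEval_step (hJ τ hτ) (hcf τ hτ) _ n' σ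
        (fun b hb => ih b hb n' r (hloc' b hb) hr (by omega)) hh
    · have hmem := skolemEval_step (hJ τ hτ) (hcf τ hτ) (unravelCopy D A (n' :: n :: r)) n' σ
        (fun b hb => ih b hb n' (n :: r) (hloc' b hb)
          (by
            intro m hm
            rcases List.mem_cons.1 hm with rfl | hm
            · exact hn'
            · exact hr m hm)
          (by simp only [List.length_cons] at hN ⊢; omega)) hh
      convert hmem using 2
      refine List.map_congr_left fun x hx => ?_
      have hx1 := hl x hx
      have hx2 : LocalTo D n' x := localTo_of_mem_head (hcf τ hτ) hl' hh hx
      rcases x with c | m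
      · rw [skolemEval_inl, skolemEval_inl]
        exact (unravelCopy_cons (r := n :: r) hx1).symm
      · exact absurd (hx2.symm.trans hx1) hnn

lemma le_arMax {S : RSig} {p : ℕ × ℕ} (h : p ∈ S) : p.2 ≤ arMax S := by
  induction S with
  | nil => simp at h
  | cons s S ih =>
    simp only [arMax, List.map_cons, List.foldr_cons] at ih ⊢
    rcases List.mem_cons.1 h with rfl | h
    · exact le_max_left _ _
    · exact (ih h).trans (le_max_right _ _)

lemma length_factArgs_le {S : RSig} {D : Database} (hD : DBover S D) (R : RSig) (n : ℕ) :
    (factArgs D n).length ≤ arMax (S ++ R) := by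
  by_cases hn : n < D.length
  · have hE : factArgs D n = D[n].2 := by simp [factArgs, hn]
    rw [hE]
    exact le_arMax (List.mem_append_left R (hD _ (List.getElem_mem hn)))
  · simp [factArgs, Nat.le_of_not_lt hn]

lemma length_flatMap_le {T : Type} (l : List T) (f : T → List ℕ) (b : ℕ)
    (h : ∀ a, (f a).length ≤ b) : (l.flatMap f).length ≤ b * l.length := by
  induction l with
  | nil => simp
  | cons a l ih =>
    have := h a
    simp only [List.flatMap_cons, List.length_append, List.length_cons, Nat.mul_succ]
    omega

lemma ncard_instAdom_root_le (D : Database) (A : List ℕ) (N : ℕ) :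
    (instAdom (inducedSub (unravel D A N) ((unravelDecomp D A N).bags []))).ncard
      ≤ A.length := by
  have hsub : instAdom (inducedSub (unravel D A N) ((unravelDecomp D A N).bags [])) ⊆
      ((A.map (unravelCopy D A [])).toFinset : Set GTerm) := by
    rintro s ⟨a, ⟨-, ha⟩, hs⟩
    obtain ⟨c, hc, rfl⟩ := ha s hs
    rw [List.coe_toFinset]
    exact List.mem_map_of_mem hc
  calc _ ≤ _ := Set.ncard_le_ncard hsub (Finset.finite_toSet _)
    _ = _ := Set.ncard_coe_finset _
    _ ≤ _ := List.toFinset_card_le _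
    _ = _ := List.length_map _

/-- tree-shaped witnesses for guarded OMQs.
Let `Q = (S, Σ, q)` be an OMQ from `(G, BCQ)` (guarded, constant-free,
single-head tgds and a Boolean CQ) and `D` an `S`-database with `D ⊨ Q`.  Then
there is a finite `S`-instance `Î` with `Î ⊨ Q` such that: (1) `Î` is a
`C`-tree with `|adom(C)| ≤ ar(S ∪ sch(Σ)) · |q|`, and (2) there is a
homomorphism from `Î` to `D`. -/
theorem statement_13 (S : RSig) (Sg : List TGD) (q : CQ)
    (hG : ∀ τ ∈ Sg, GuardedTGD τ ∧ SingleHead τ ∧ TGDConstFree τ)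
    (hqB : q.1 = ([] : List ℕ)) (hqcf : CQConstFree q)
    (D : Database) (hD : DBover S D)
    (hsat : ([] : List ℕ) ∈ omqEval (S, Sg, q) D) :
    ∃ I : Inst, I.Finite ∧ InstOver S I ∧ ([] : List ℕ) ∈ certAnsI Sg q I ∧
      (∃ C : Inst, IsCTree I C ∧
        (instAdom C).ncard ≤ arMax (S ++ schList Sg) * q.2.length) ∧
      ∃ h : GTerm → GTerm, IsHomI h I (dbInst D) := by
  have hG' : ∀ τ ∈ Sg, GuardedTGD τ := fun τ hτ => (hG τ hτ).1
  have hcf : ∀ τ ∈ Sg, TGDConstFree τ := fun τ hτ => (hG τ hτ).2.2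
  obtain ⟨ν, hν, -⟩ := hsat {a | ∃ k, ChaseStage D Sg k a}
    (by rintro a ⟨f, hf, rfl⟩; exact ⟨0, .base 0 f hf⟩) (satAll_chase hG' hcf)
  obtain ⟨k, hk⟩ := ChaseStage.exists_common q.2 (applyA ν) hν
  have hloc : ∀ α : RAtom QTerm, ∃ n, α ∈ q.2 →
      n < D.length ∧ ∀ x ∈ (applyA ν α).2, LocalTo D n x := by
    intro α
    by_cases hα : α ∈ q.2
    · obtain ⟨n, hn⟩ := (hk α hα).exists_local hcf
      exact ⟨n, fun _ => hn⟩
    · exact ⟨0, fun h => absurd h hα⟩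
  choose n hn using hloc
  set A : List ℕ := q.2.flatMap fun α => factArgs D (n α)
  refine ⟨unravel D A (k + 1), unravel_finite _ _ _, instOver_unravel hD _ _, ?_,
    ⟨_, ⟨fun a ha => ha.1, unravelDecomp D A (k + 1), rfl, guardedExcept_unravelDecomp _ _ _⟩,
      (ncard_instAdom_root_le _ _ _).trans
        (length_flatMap_le _ _ _ fun α => length_factArgs_le hD _ _)⟩,
    unravelProj, isHomI_unravelProj _ _ _⟩
  intro J hI hJ
  let val : GTerm → GTerm := Sum.elim (unravelCopy D A [])
    fun m => skolemEval J (unravelCopy D A [(skolemDecode m).1]) (Sum.inr m)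
  refine ⟨fun v => val (ν v), fun α hα => ?_, by simp [hqB]⟩
  obtain ⟨hlt, hl⟩ := hn α hα
  have hmem := (hk α hα).eval_mem hcf hI hJ (n α) [] hl (by simpa using hlt)
    (by simp only [List.length_cons, List.length_nil]; omega)
  convert hmem using 1
  refine Prod.ext rfl ?_
  simp only [applyA, List.map_map]
  refine List.map_congr_left fun x hx => ?_
  have hlx := hl _ (List.mem_map_of_mem hx)
  obtain ⟨v, rfl⟩ := exists_var_of_constFree hqcf hα hx
  change val (ν v) = skolemEval J _ (ν v)
  change LocalTo D (n α) (ν v) at hlx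
  rcases hv : ν v with c | m
  · rw [hv] at hlx
    rw [skolemEval_inl]
    exact (unravelCopy_cons (List.mem_flatMap.2 ⟨α, hα, hlx⟩)).symm
  · rw [hv] at hlx
    have hlx' : (skolemDecode m).1 = n α := hlx
    simp [val, hlx']
end

section
/- Let Q_1 = (S, Σ_1, q_1) and Q_2 = (S, Σ_2, q_2) be OMQs from (G, BCQ) over the same data schema S, where Σ_1, Σ_2 are finite sets of guarded, constant-free, single-head tgds and q_1, q_2 are Boolean CQs. Then Q_1 ⊆ Q_2 if and only if Q_1(D) ⊆ Q_2(D) for every S-database D that is a C-tree with |adom(C)| ≤ ar(S ∪ sch(Σ_1)) · |q_1|. Equivalently, non-containment of Q_1 in Q_2 is always witnessed by such a C-tree database. -/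
namespace GuardedOMQ

/-- The image of an atom under a map of terms. -/
def mapAtom {α β : Type} (g : α → β) (a : RAtom α) : RAtom β := (a.1, a.2.map g)

theorem mapAtom_mapAtom {α β γ : Type} (g : β → γ) (h : α → β) (a : RAtom α) :
    mapAtom g (mapAtom h a) = mapAtom (g ∘ h) a := by
  simp [mapAtom]

theorem mapAtom_congr {α β : Type} {g h : α → β} {a : RAtom α} (H : ∀ t ∈ a.2, g t = h t) :
    mapAtom g a = mapAtom h a := by
  simp only [mapAtom, Prod.mk.injEq, true_and]
  exact List.map_congr_left H

theorem mapAtom_eq_self {α : Type} {g : α → α} {a : RAtom α} (H : ∀ t ∈ a.2, g t = t) :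
    mapAtom g a = a := by
  rw [mapAtom_congr (h := id) H]
  simp [mapAtom]

theorem mapAtom_elim_congr {α : Type} {γ γ' ν ν' : ℕ → α} {a : RAtom QTerm}
    (hcf : ∀ c : ℕ, (Sum.inl c : QTerm) ∉ a.2)
    (H : ∀ v : ℕ, (Sum.inr v : QTerm) ∈ a.2 → ν v = ν' v) :
    mapAtom (Sum.elim γ ν) a = mapAtom (Sum.elim γ' ν') a := by
  refine mapAtom_congr fun t ht => ?_
  rcases t with c | v
  · exact absurd ht (hcf c)
  · exact H v ht

theorem mapAtom_comp_elim {α β : Type} (g : α → β) {γ : ℕ → α} {γ' : ℕ → β} {ν : ℕ → α}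
    {a : RAtom QTerm} (hcf : ∀ c : ℕ, (Sum.inl c : QTerm) ∉ a.2) :
    mapAtom g (mapAtom (Sum.elim γ ν) a) = mapAtom (Sum.elim γ' (g ∘ ν)) a := by
  rw [mapAtom_mapAtom, Sum.comp_elim]
  exact mapAtom_elim_congr hcf fun _ _ => rfl

/-- Satisfaction of a tgd over an arbitrary domain whose constants are named by `γ`. -/
def Sat {α : Type} (γ : ℕ → α) (I : GInst α) (τ : TGD) : Prop :=
  ∀ ν : ℕ → α, (∀ a ∈ τ.1, mapAtom (Sum.elim γ ν) a ∈ I) →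
    ∃ ν' : ℕ → α, (∀ v ∈ varsOf τ.1, ν' v = ν v) ∧
      ∀ a ∈ τ.2, mapAtom (Sum.elim γ ν') a ∈ I

/-- Models of constant-free tgds can be pulled back along surjections. -/
theorem satAll_pullback {α : Type} {γ : ℕ → α} {g : GTerm → α} (hg : Function.Surjective g)
    {I : GInst α} {Sg : List TGD} (hcf : ∀ τ ∈ Sg, TGDConstFree τ)
    (hsat : ∀ τ ∈ Sg, Sat γ I τ) : satAll {a | mapAtom g a ∈ I} Sg := by
  classical
  intro τ hτ ν hν
  obtain ⟨μ, hμ, hμI⟩ := hsat τ hτ (g ∘ ν) fun a ha => by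
    rw [← mapAtom_comp_elim (γ := Sum.inl) g ((hcf τ hτ).1 a ha)]
    exact hν a ha
  obtain ⟨s, hs⟩ := hg.hasRightInverse
  refine ⟨fun v => if v ∈ varsOf τ.1 then ν v else s (μ v), fun v hv => if_pos hv,
    fun a ha => ?_⟩
  change mapAtom g (mapAtom (Sum.elim Sum.inl _) a) ∈ I
  rw [mapAtom_comp_elim (γ' := γ) g ((hcf τ hτ).2 a ha)]
  convert hμI a ha using 1
  refine mapAtom_elim_congr ((hcf τ hτ).2 a ha) fun v _ => ?_
  by_cases hv : v ∈ varsOf τ.1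
  · simp [hv, hμ v hv]
  · simp [hv, hs (μ v)]

/-- The variables of the body of a tgd. -/
def bodyVars (τ : TGD) : Finset ℕ := (τ.1.flatMap fun a => a.2.filterMap Sum.getRight?).toFinset

theorem mem_bodyVars {τ : TGD} {v : ℕ} : v ∈ bodyVars τ ↔ v ∈ varsOf τ.1 := by
  simp [bodyVars, varsOf]

/-- Skolem terms: constants, and nulls invented by a tgd for an existential variable and a
valuation of the body variables. -/
inductive Tm : Type
  | const (n : ℕ) : Tm
  | sk (τ : TGD) (z : ℕ) (args : {v // v ∈ bodyVars τ} → Tm) : Tm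

namespace Tm

/-- The branching type of a Skolem term with the given root symbol. -/
def Branch : ℕ ⊕ TGD × ℕ → Type
  | Sum.inl _ => Empty
  | Sum.inr p => {v // v ∈ bodyVars p.1}

instance : ∀ s, Fintype (Branch s)
  | Sum.inl _ => inferInstanceAs (Fintype Empty)
  | Sum.inr p => inferInstanceAs (Fintype {v // v ∈ bodyVars p.1})

instance : ∀ s, Encodable (Branch s)
  | Sum.inl _ => inferInstanceAs (Encodable Empty)
  | Sum.inr p => inferInstanceAs (Encodable {v // v ∈ bodyVars p.1})

/-- Skolem terms as elements of a W-type. -/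
def toW : Tm → WType Branch
  | const n => ⟨Sum.inl n, fun b : Branch (Sum.inl n) => Empty.elim b⟩
  | sk τ z args => ⟨Sum.inr (τ, z), fun v => (args v).toW⟩

theorem toW_injective : Function.Injective toW := by
  intro s
  induction s with
  | const n =>
    rintro (m | ⟨τ, z, args⟩) h
    · simp only [toW, WType.mk.injEq, Sum.inl.injEq] at h
      rw [h.1]
    · simp [toW] at h
  | sk τ z args ih =>
    rintro (m | ⟨τ', z', args'⟩) h
    · simp [toW] at h
    · simp only [toW, WType.mk.injEq, Sum.inr.injEq, Prod.mk.injEq] at h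
      obtain ⟨⟨rfl, rfl⟩, h⟩ := h
      have h := eq_of_heq h
      congr 1
      funext v
      exact ih v (congrFun h v)

instance : Countable Tm := toW_injective.countable

instance : Nonempty Tm := ⟨const 0⟩

/-- The constants occurring in a Skolem term. -/
def consts : Tm → Set ℕ
  | const n => {n}
  | sk _ _ args => {c | ∃ v, c ∈ (args v).consts}

/-- Renaming of the constants of a Skolem term. -/
def map (ρ : ℕ → ℕ) : Tm → Tm
  | const n => const (ρ n)
  | sk τ z args => sk τ z fun v => (args v).map ρ

theorem map_eq_self {ρ : ℕ → ℕ} {t : Tm} (h : ∀ c ∈ t.consts, ρ c = c) : t.map ρ = t := by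
  induction t with
  | const n => simp [map, h n rfl]
  | sk τ z args ih =>
    simp only [map]
    congr 1
    funext v
    exact ih v fun c hc => h c ⟨v, hc⟩

end Tm

/-- The constants occurring in an atom over Skolem terms. -/
def atomConsts (a : RAtom Tm) : Set ℕ := {c | ∃ t ∈ a.2, c ∈ t.consts}

theorem mapAtom_map_eq_self {ρ : ℕ → ℕ} {a : RAtom Tm} (h : ∀ c ∈ atomConsts a, ρ c = c) :
    mapAtom (Tm.map ρ) a = a :=
  mapAtom_eq_self fun t ht => Tm.map_eq_self fun c hc => h c ⟨t, ht, hc⟩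

open Classical in
/-- The extension of a valuation of the body of a tgd to existential variables by Skolem terms. -/
noncomputable def skolem (τ : TGD) (ν : ℕ → Tm) (v : ℕ) : Tm :=
  if v ∈ varsOf τ.1 then ν v else Tm.sk τ v fun w => ν w

/-- The oblivious Skolem chase. -/
inductive Chase (Sg : List TGD) (D : Database) : RAtom Tm → Prop
  | base (f : DBFact) (hf : f ∈ D) : Chase Sg D (mapAtom Tm.const f)
  | step (τ : TGD) (hτ : τ ∈ Sg) (ν : ℕ → Tm)
      (hν : ∀ a ∈ τ.1, Chase Sg D (mapAtom (Sum.elim Tm.const ν) a)) (b : RAtom QTerm)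
      (hb : b ∈ τ.2) : Chase Sg D (mapAtom (Sum.elim Tm.const (skolem τ ν)) b)

namespace Chase

variable {Sg : List TGD} {D : Database}

theorem mono {D' : Database} (h : D ⊆ D') {a : RAtom Tm} (ha : Chase Sg D a) :
    Chase Sg D' a := by
  induction ha with
  | base f hf => exact base f (h hf)
  | step τ hτ ν _ b hb ih => exact step τ hτ ν ih b hb

theorem sat {τ : TGD} (hτ : τ ∈ Sg) : Sat Tm.const {a | Chase Sg D a} τ := fun ν hν =>
  ⟨skolem τ ν, fun _ hv => if_pos hv, fun a ha => step τ hτ ν hν a ha⟩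

theorem rename (hcf : ∀ τ ∈ Sg, TGDConstFree τ) (ρ : ℕ → ℕ) {a : RAtom Tm}
    (ha : Chase Sg D a) : Chase Sg (D.map (mapAtom ρ)) (mapAtom (Tm.map ρ) a) := by
  induction ha with
  | base f hf =>
    have := base (Sg := Sg) (D := D.map (mapAtom ρ)) (mapAtom ρ f) (List.mem_map_of_mem hf)
    rw [mapAtom_mapAtom] at this ⊢
    exact this
  | step τ hτ ν _ b hb ih =>
    have := step (Sg := Sg) (D := D.map (mapAtom ρ)) τ hτ (Tm.map ρ ∘ ν) (fun a ha => by
      rw [← mapAtom_comp_elim (γ := Tm.const) _ ((hcf τ hτ).1 a ha)]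
      exact ih a ha) b hb
    rw [mapAtom_comp_elim (γ' := Tm.const) _ ((hcf τ hτ).2 b hb)]
    convert this using 3
    funext v
    by_cases hv : v ∈ varsOf τ.1 <;> simp [skolem, hv, Tm.map]

/-- A certain Boolean conjunctive query has a match in the chase. -/
theorem exists_match (hcf : ∀ τ ∈ Sg, TGDConstFree τ) {q : CQ} (hq : q.1 = [])
    (hqcf : CQConstFree q) {c : List ℕ} (hc : c ∈ certAns Sg q D) :
    c = [] ∧ ∃ ν : ℕ → Tm, ∀ a ∈ q.2, Chase Sg D (mapAtom (Sum.elim Tm.const ν) a) := by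
  obtain ⟨e, he⟩ := exists_surjective_nat Tm
  let g : GTerm → Tm := Sum.elim Tm.const e
  have hg : Function.Surjective g := fun t => (he t).imp' Sum.inr fun _ h => h
  obtain ⟨ν, hν, hνc⟩ := hc {a | mapAtom g a ∈ {a | Chase Sg D a}}
    (by
      rintro _ ⟨f, hf, rfl⟩
      change Chase Sg D (mapAtom g (mapAtom Sum.inl f))
      rw [mapAtom_mapAtom]
      exact base f hf)
    (satAll_pullback hg hcf fun τ hτ => sat hτ)
  refine ⟨by simpa [hq] using hνc.symm, g ∘ ν, fun a ha => ?_⟩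
  rw [← mapAtom_comp_elim (γ := Sum.inl) g (hqcf a ha)]
  exact hν a ha

open Classical in
/-- The interpretation in a model `J` of the null invented by `τ` for the variable `z`. -/
noncomputable def evalNull (J : Inst) (τ : TGD) (z : ℕ) (u : {v // v ∈ bodyVars τ} → GTerm) :
    GTerm :=
  if h : ∃ ν' : Assign, (∀ v (hv : v ∈ bodyVars τ), ν' v = u ⟨v, hv⟩) ∧
      ∀ a ∈ τ.2, applyA ν' a ∈ J then h.choose z else Sum.inl 0

/-- The homomorphism from Skolem terms to a model `J`. -/
noncomputable def eval (J : Inst) : Tm → GTerm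
  | Tm.const n => Sum.inl n
  | Tm.sk τ z args => evalNull J τ z fun v => eval J (args v)

theorem mem_of_model (hcf : ∀ τ ∈ Sg, TGDConstFree τ) {J : Inst} (hD : dbInst D ⊆ J)
    (hJ : satAll J Sg) {a : RAtom Tm} (ha : Chase Sg D a) : mapAtom (eval J) a ∈ J := by
  classical
  induction ha with
  | base f hf =>
    rw [mapAtom_mapAtom]
    exact hD ⟨f, hf, rfl⟩
  | step τ hτ ν _ b hb ih =>
    have hbody : ∀ a ∈ τ.1, applyA (eval J ∘ ν) a ∈ J := fun a ha => by
      have := ih a ha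
      rwa [mapAtom_comp_elim (γ' := Sum.inl) _ ((hcf τ hτ).1 a ha)] at this
    have hex : ∃ ν' : Assign, (∀ v, v ∈ bodyVars τ → ν' v = eval J (ν v)) ∧
        ∀ a ∈ τ.2, applyA ν' a ∈ J := by
      obtain ⟨ν', h1, h2⟩ := hJ τ hτ _ hbody
      exact ⟨ν', fun v hv => h1 v (mem_bodyVars.1 hv), h2⟩
    rw [mapAtom_comp_elim (γ' := Sum.inl) _ ((hcf τ hτ).2 b hb)]
    convert hex.choose_spec.2 b hb using 1
    refine mapAtom_elim_congr ((hcf τ hτ).2 b hb) fun v _ => ?_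
    by_cases hv : v ∈ varsOf τ.1
    · simp [skolem, hv, hex.choose_spec.1 v (mem_bodyVars.2 hv)]
    · simp only [Function.comp, skolem, if_neg hv, eval, evalNull]
      rw [dif_pos hex]

/-- A match of a Boolean conjunctive query in the chase makes the query certain. -/
theorem certAns_of_match (hcf : ∀ τ ∈ Sg, TGDConstFree τ) {q : CQ} (hq : q.1 = [])
    (hqcf : CQConstFree q) {ν : ℕ → Tm}
    (hν : ∀ a ∈ q.2, Chase Sg D (mapAtom (Sum.elim Tm.const ν) a)) : [] ∈ certAns Sg q D := by
  intro J hD hJ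
  refine ⟨eval J ∘ ν, fun a ha => ?_, by simp [hq]⟩
  have := mem_of_model hcf hD hJ (hν a ha)
  rwa [mapAtom_comp_elim (γ' := Sum.inl) _ (hqcf a ha)] at this

theorem atomConsts_body_subset {τ : TGD} (hcf : TGDConstFree τ) {g : RAtom QTerm}
    (hg : ∀ v ∈ varsOf τ.1, (Sum.inr v : QTerm) ∈ g.2) (ν : ℕ → Tm) {a : RAtom QTerm}
    (ha : a ∈ τ.1) : atomConsts (mapAtom (Sum.elim Tm.const ν) a) ⊆
      atomConsts (mapAtom (Sum.elim Tm.const ν) g) := by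
  rintro c ⟨t, ht, hc⟩
  obtain ⟨s, hs, rfl⟩ := List.mem_map.1 ht
  rcases s with n | v
  · exact absurd hs (hcf.1 a ha n)
  · exact ⟨_, List.mem_map_of_mem (hg v ⟨a, ha, hs⟩), hc⟩

theorem atomConsts_head_subset {τ : TGD} (hcf : TGDConstFree τ) {g : RAtom QTerm}
    (hg : ∀ v ∈ varsOf τ.1, (Sum.inr v : QTerm) ∈ g.2) (ν : ℕ → Tm) {b : RAtom QTerm}
    (hb : b ∈ τ.2) : atomConsts (mapAtom (Sum.elim Tm.const (skolem τ ν)) b) ⊆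
      atomConsts (mapAtom (Sum.elim Tm.const ν) g) := by
  rintro c ⟨t, ht, hc⟩
  obtain ⟨s, hs, rfl⟩ := List.mem_map.1 ht
  rcases s with n | v
  · exact absurd hs (hcf.2 b hb n)
  · by_cases hv : v ∈ varsOf τ.1
    · simp only [Sum.elim_inr, skolem, if_pos hv] at hc
      exact ⟨_, List.mem_map_of_mem (hg v hv), hc⟩
    · simp only [Sum.elim_inr, skolem, if_neg hv] at hc
      obtain ⟨⟨w, hw⟩, hc⟩ := hc
      exact ⟨_, List.mem_map_of_mem (hg w (mem_bodyVars.1 hw)), hc⟩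

/-- The constants of every atom of a guarded chase are guarded by a fact of the database. -/
theorem exists_guard (hG : ∀ τ ∈ Sg, GuardedTGD τ ∧ TGDConstFree τ) {a : RAtom Tm}
    (ha : Chase Sg D a) : ∃ d ∈ D, ∀ c ∈ atomConsts a, c ∈ d.2 := by
  induction ha with
  | base f hf =>
    refine ⟨f, hf, ?_⟩
    rintro c ⟨t, ht, hc⟩
    obtain ⟨n, hn, rfl⟩ := List.mem_map.1 ht
    obtain rfl : c = n := hc
    exact hn
  | step τ hτ ν _ b hb ih =>
    obtain ⟨⟨g, hg, hgv⟩, hcf⟩ := hG τ hτ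
    obtain ⟨d, hd, hdc⟩ := ih g hg
    exact ⟨d, hd, fun c hc => hdc c (atomConsts_head_subset hcf hgv ν hb hc)⟩

end Chase

/-- `T` has a tree decomposition with root bag `X` which is guarded except for the root. -/
structure TreeShape (T : Database) (X : Set ℕ) where
  nodes : Set (List ℕ)
  bags : List ℕ → Set ℕ
  root_mem : [] ∈ nodes
  prefix_closed : ∀ x ∈ nodes, ∀ y : List ℕ, y <+: x → y ∈ nodes
  root_bag : bags [] = X
  cover : ∀ f ∈ T, ∃ t ∈ nodes, ∀ x ∈ f.2, x ∈ bags t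
  connected : ∀ v, ∀ t1 ∈ nodes, ∀ t2 ∈ nodes, ∀ z ∈ nodes,
    v ∈ bags t1 → v ∈ bags t2 → (z <+: t1 ∨ z <+: t2) →
    (∀ w : List ℕ, w <+: t1 → w <+: t2 → w <+: z) → v ∈ bags z
  guarded : ∀ t ∈ nodes, t ≠ [] → ∃ f ∈ T, ∀ x ∈ bags t, x ∈ f.2

/-- `T` is tree-shaped with root bag `X` and maps to `D` by a homomorphism fixing `X`. -/
def IsUnraveling (D T : Database) (X : Set ℕ) : Prop :=
  (∃ f : ℕ → ℕ, (∀ x ∈ X, f x = x) ∧ ∀ a ∈ T, mapAtom f a ∈ D) ∧ Nonempty (TreeShape T X)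

theorem TreeShape.mem_of_root {T : Database} {X : Set ℕ} (δ : TreeShape T X) {v : ℕ}
    (hv : v ∈ X) {t z : List ℕ} (ht : t ∈ δ.nodes) (hvt : v ∈ δ.bags t) (hz : z <+: t) :
    v ∈ δ.bags z :=
  δ.connected v [] δ.root_mem t ht z (δ.prefix_closed t ht z hz) (by rwa [δ.root_bag]) hvt
    (Or.inr hz) fun _ hw _ => by simp [List.prefix_nil.1 hw]

/-- Bags obtained by joining a family of trees below a new root. -/
def joinBags (A : Set ℕ) (bags : ℕ → List ℕ → Set ℕ) : List ℕ → Set ℕ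
  | [] => A
  | i :: t => bags i t

theorem nonempty_treeShape_join {A : Set ℕ} {B : Database} (hB : ∀ a ∈ B, ∀ x ∈ a.2, x ∈ A)
    {n : ℕ} {T : ℕ → Database} {X : ℕ → Set ℕ} (δ : ∀ i, i < n → TreeShape (T i) (X i))
    (hT : ∀ i < n, ∃ f ∈ T i, ∀ x ∈ X i, x ∈ f.2) {ρ : ℕ → ℕ → ℕ}
    (hinj : ∀ i, Function.Injective (ρ i))
    (hA : ∀ i x, ρ i x ∈ A → x ∈ A ∩ X i)
    (hdisj : ∀ i j x y, i ≠ j → ρ i x = ρ j y → ρ i x ∈ A) :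
    Nonempty (TreeShape
      (B ++ (List.range n).flatMap fun i => (T i).map (mapAtom (ρ i))) A) := by
  classical
  let bg : ℕ → List ℕ → Set ℕ := fun i t => if h : i < n then ρ i '' (δ i h).bags t else ∅
  have hbg : ∀ i (h : i < n) t, bg i t = ρ i '' (δ i h).bags t := fun i h t => dif_pos h
  have hdown : ∀ i (h : i < n) v t z, v ∈ A → t ∈ (δ i h).nodes → v ∈ bg i t → z <+: t →
      v ∈ bg i z := by
    intro i h v t z hv ht hvt hz
    rw [hbg i h] at hvt ⊢
    obtain ⟨x, hx, rfl⟩ := hvt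
    exact ⟨x, (δ i h).mem_of_root (hA i x hv).2 ht hx hz, rfl⟩
  have hmem : ∀ i, i < n → ∀ f ∈ T i, mapAtom (ρ i) f ∈
      B ++ (List.range n).flatMap fun i => (T i).map (mapAtom (ρ i)) := fun i hi f hf =>
    List.mem_append_right _ (List.mem_flatMap.2
      ⟨i, List.mem_range.2 hi, List.mem_map_of_mem hf⟩)
  refine ⟨{
    nodes := {t | t = [] ∨ ∃ i, ∃ h : i < n, ∃ s ∈ (δ i h).nodes, t = i :: s}
    bags := joinBags A bg
    root_mem := Or.inl rfl
    prefix_closed := ?_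
    root_bag := rfl
    cover := ?_
    connected := ?_
    guarded := ?_ }⟩
  · rintro x hx y hy
    rcases hx with rfl | ⟨i, h, s, hs, rfl⟩
    · exact Or.inl (List.prefix_nil.1 hy)
    · rcases List.prefix_cons_iff.1 hy with rfl | ⟨y', rfl, hy'⟩
      · exact Or.inl rfl
      · exact Or.inr ⟨i, h, y', (δ i h).prefix_closed s hs y' hy', rfl⟩
  · intro f hf
    rcases List.mem_append.1 hf with hf | hf
    · exact ⟨[], Or.inl rfl, hB f hf⟩
    · obtain ⟨i, hi, hf⟩ := List.mem_flatMap.1 hf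
      obtain ⟨f', hf', rfl⟩ := List.mem_map.1 hf
      have hi := List.mem_range.1 hi
      obtain ⟨t, ht, hft⟩ := (δ i hi).cover f' hf'
      refine ⟨i :: t, Or.inr ⟨i, hi, t, ht, rfl⟩, fun x hx => ?_⟩
      obtain ⟨y, hy, rfl⟩ := List.mem_map.1 hx
      change _ ∈ bg i t
      rw [hbg i hi]
      exact ⟨y, hft y hy, rfl⟩
  · rintro v t1 (rfl | ⟨i, hi, s1, hs1, rfl⟩) t2 (rfl | ⟨j, hj, s2, hs2, rfl⟩) z
      (rfl | ⟨k, hk, s, hs, rfl⟩) h1 h2 hz hw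
    · exact h1
    · simp at hz
    · exact h1
    · obtain ⟨rfl, hz'⟩ : k = j ∧ s <+: s2 := by simpa using hz
      exact hdown k hj v s2 s h1 hs2 h2 hz'
    · exact h2
    · obtain ⟨rfl, hz'⟩ : k = i ∧ s <+: s1 := by simpa using hz
      exact hdown k hi v s1 s h2 hs1 h1 hz'
    · have hij : i ≠ j := by
        rintro rfl
        simpa using hw [i] (by simp) (by simp)
      change v ∈ bg i s1 at h1
      change v ∈ bg j s2 at h2
      rw [hbg i hi] at h1
      rw [hbg j hj] at h2
      obtain ⟨x, -, rfl⟩ := h1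
      obtain ⟨y, -, hy⟩ := h2
      exact hdisj i j x y hij hy.symm
    · change v ∈ bg i s1 at h1
      change v ∈ bg j s2 at h2
      change v ∈ bg k s
      by_cases hij : i = j
      · subst hij
        obtain rfl : i = k := by simpa using hw [i] (by simp) (by simp)
        rw [hbg i hi] at h1 h2 ⊢
        obtain ⟨x, hx, rfl⟩ := h1
        obtain ⟨y, hy, hxy⟩ := h2
        obtain rfl := hinj i hxy
        refine ⟨y, (δ i hi).connected y s1 hs1 s2 hs2 s hs hx hy (by simpa using hz) ?_, rfl⟩
        intro w hw1 hw2
        simpa using hw (i :: w) (by simpa using hw1) (by simpa using hw2)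
      · have hv : v ∈ A := by
          rw [hbg i hi] at h1
          rw [hbg j hj] at h2
          obtain ⟨x, -, rfl⟩ := h1
          obtain ⟨y, -, hy⟩ := h2
          exact hdisj i j x y hij hy.symm
        rcases hz with hz | hz
        · obtain ⟨rfl, hz'⟩ : k = i ∧ s <+: s1 := by simpa using hz
          exact hdown k hi v s1 s hv hs1 h1 hz'
        · obtain ⟨rfl, hz'⟩ : k = j ∧ s <+: s2 := by simpa using hz
          exact hdown k hj v s2 s hv hs2 h2 hz'
  · rintro t (rfl | ⟨i, hi, s, hs, rfl⟩) ht
    · exact absurd rfl ht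
    · obtain ⟨f, hf, hsf⟩ : ∃ f ∈ T i, ∀ x ∈ (δ i hi).bags s, x ∈ f.2 := by
        by_cases hs0 : s = []
        · subst hs0
          rw [(δ i hi).root_bag]
          exact hT i hi
        · exact (δ i hi).guarded s hs hs0
      refine ⟨_, hmem i hi f hf, fun x hx => ?_⟩
      change x ∈ bg i s at hx
      rw [hbg i hi] at hx
      obtain ⟨y, hy, rfl⟩ := hx
      exact List.mem_map_of_mem (hsf y hy)

/-- Unravelings with guarded root bags can be joined below a new root bag `A`. -/
theorem IsUnraveling.exists_join {Sg : List TGD} (hcf : ∀ τ ∈ Sg, TGDConstFree τ)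
    {D : Database} (A : Finset ℕ) {B : Database}
    (hB : ∀ a ∈ B, a ∈ D ∧ ∀ x ∈ a.2, x ∈ A) {n : ℕ} {T : ℕ → Database} {X : ℕ → Set ℕ}
    (h : ∀ i < n, IsUnraveling D (T i) (X i) ∧ ∃ f ∈ T i, ∀ x ∈ X i, x ∈ f.2) :
    ∃ T', IsUnraveling D T' A ∧ B ⊆ T' ∧ ∀ i < n, ∀ a : RAtom Tm, Chase Sg (T i) a →
      (∀ c ∈ atomConsts a, c ∈ A ∧ c ∈ X i) → Chase Sg T' a := by
  classical
  obtain ⟨M, hM⟩ : ∃ M, ∀ x ∈ A, x < M :=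
    ⟨A.sup id + 1, fun x hx => Nat.lt_succ_of_le (Finset.le_sup (f := id) hx)⟩
  choose! f hfX hfD using fun i hi => (h i hi).1.1
  let ρ : ℕ → ℕ → ℕ := fun i x => if x ∈ A ∧ x ∈ X i then x else M + Nat.pair i x
  have hpos : ∀ i x, x ∈ A ∧ x ∈ X i → ρ i x = x := fun i x hx => if_pos hx
  have hneg : ∀ i x, ¬ (x ∈ A ∧ x ∈ X i) → ρ i x = M + Nat.pair i x := fun i x hx => if_neg hx
  have hρA : ∀ i x, ρ i x ∈ A → x ∈ A ∧ x ∈ X i := by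
    intro i x hx
    by_contra hn
    rw [hneg i x hn] at hx
    have := hM _ hx
    omega
  let F : ℕ → ℕ := fun y => if y < M then y else
    f (Nat.unpair (y - M)).1 (Nat.unpair (y - M)).2
  have hF : ∀ i < n, ∀ x, F (ρ i x) = f i x := by
    intro i hi x
    by_cases hx : x ∈ A ∧ x ∈ X i
    · rw [hpos i x hx, hfX i hi x hx.2]
      exact if_pos (hM x hx.1)
    · rw [hneg i x hx]
      simp [F]
  have hsub : ∀ i < n, (T i).map (mapAtom (ρ i)) ⊆
      B ++ (List.range n).flatMap fun i => (T i).map (mapAtom (ρ i)) := fun i hi a ha =>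
    List.mem_append_right _ (List.mem_flatMap.2 ⟨i, List.mem_range.2 hi, ha⟩)
  refine ⟨B ++ (List.range n).flatMap fun i => (T i).map (mapAtom (ρ i)),
    ⟨⟨F, fun x hx => if_pos (hM x hx), ?_⟩, ?_⟩, fun a ha => List.mem_append_left _ ha, ?_⟩
  · intro a ha
    rcases List.mem_append.1 ha with ha | ha
    · rw [mapAtom_eq_self fun x hx => if_pos (hM x ((hB a ha).2 x hx))]
      exact (hB a ha).1
    · obtain ⟨i, hi, ha⟩ := List.mem_flatMap.1 ha
      obtain ⟨a', ha', rfl⟩ := List.mem_map.1 ha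
      have hi := List.mem_range.1 hi
      rw [mapAtom_mapAtom, mapAtom_congr (g := F ∘ ρ i) (h := f i) fun x _ => hF i hi x]
      exact hfD i hi a' ha'
  · refine nonempty_treeShape_join (fun a ha => (hB a ha).2)
      (fun i hi => (h i hi).1.2.some) (fun i hi => (h i hi).2) (fun i x y hxy => ?_) hρA
      (fun i j x y hij hxy => ?_)
    · by_cases hx : x ∈ A ∧ x ∈ X i
      · have hy := hρA i y (by rw [← hxy, hpos i x hx]; exact hx.1)
        rwa [hpos i x hx, hpos i y hy] at hxy
      · by_cases hy : y ∈ A ∧ y ∈ X i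
        · exact absurd (hρA i x (by rw [hxy, hpos i y hy]; exact hy.1)) hx
        · rw [hneg i x hx, hneg i y hy, Nat.add_left_cancel_iff, Nat.pair_eq_pair] at hxy
          exact hxy.2
    · by_cases hx : x ∈ A ∧ x ∈ X i
      · rw [hpos i x hx]
        exact hx.1
      · by_cases hy : y ∈ A ∧ y ∈ X j
        · rw [hxy, hpos j y hy]
          exact hy.1
        · rw [hneg i x hx, hneg j y hy, Nat.add_left_cancel_iff, Nat.pair_eq_pair] at hxy
          exact absurd hxy.1 hij
  · intro i hi a ha hac
    rw [← mapAtom_map_eq_self fun c hc => hpos i c (hac c hc)]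
    exact (ha.rename hcf (ρ i)).mono (hsub i hi)

/-- Every atom of a guarded chase is derivable from an unraveling rooted at any fact that
guards its constants. -/
theorem Chase.exists_unraveling {Sg : List TGD} (hG : ∀ τ ∈ Sg, GuardedTGD τ ∧ TGDConstFree τ)
    {D : Database} {a : RAtom Tm} (ha : Chase Sg D a) {d : DBFact} (hd : d ∈ D)
    (hda : ∀ c ∈ atomConsts a, c ∈ d.2) :
    ∃ T, IsUnraveling D T {x | x ∈ d.2} ∧ d ∈ T ∧ Chase Sg T a := by
  have hcf : ∀ τ ∈ Sg, TGDConstFree τ := fun τ hτ => (hG τ hτ).2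
  induction ha generalizing d with
  | base f hf =>
    obtain ⟨T, hT, hBT, -⟩ := IsUnraveling.exists_join hcf (D := D) d.2.toFinset (B := [d, f])
      (n := 0) (T := fun _ => []) (X := fun _ => ∅) (by
        simp only [List.mem_cons, List.not_mem_nil, or_false, List.mem_toFinset]
        rintro a (rfl | rfl)
        · exact ⟨hd, fun _ h => h⟩
        · exact ⟨hf, fun x hx => hda x ⟨_, List.mem_map_of_mem hx, rfl⟩⟩) (by simp)
    exact ⟨T, by simpa using hT, hBT (by simp), base f (hBT (by simp))⟩
  | step τ hτ ν hν b hb ih =>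
    obtain ⟨⟨g, hg, hgv⟩, hcfτ⟩ := hG τ hτ
    obtain ⟨e, he, hge⟩ := (hν g hg).exists_guard hG
    have hbody : ∀ a ∈ τ.1, ∀ c ∈ atomConsts (mapAtom (Sum.elim Tm.const ν) a), c ∈ e.2 :=
      fun a ha c hc => hge c (atomConsts_body_subset hcfτ hgv ν ha hc)
    choose! T hT heT hTa using fun a ha => ih a ha he (hbody a ha)
    obtain ⟨T₁, hT₁, heT₁, hT₁a⟩ := IsUnraveling.exists_join hcf (D := D) e.2.toFinset
      (B := [e]) (n := τ.1.length) (T := fun i => T (τ.1.getD i default))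
      (X := fun _ => {x | x ∈ e.2}) (by simpa using he) (fun i hi => by
        have hmem : τ.1.getD i default ∈ τ.1 := by simp [hi]
        exact ⟨hT _ hmem, e, heT _ hmem, fun _ h => h⟩)
    have hb₁ : Chase Sg T₁ (mapAtom (Sum.elim Tm.const (skolem τ ν)) b) := by
      refine step τ hτ ν (fun a ha => ?_) b hb
      obtain ⟨i, hi, rfl⟩ := List.getElem_of_mem ha
      refine hT₁a i hi _ ?_ fun c hc => ?_
      · simpa [hi] using hTa _ ha
      · simpa using hbody _ ha c hc
    obtain ⟨T₂, hT₂, hdT₂, hT₂a⟩ := IsUnraveling.exists_join hcf (D := D) d.2.toFinset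
      (B := [d]) (n := 1) (T := fun _ => T₁) (X := fun _ => {x | x ∈ e.2}) (by simpa using hd)
      (fun i _ => ⟨by simpa using hT₁, e, heT₁ (by simp), fun _ h => h⟩)
    refine ⟨T₂, by simpa using hT₂, hdT₂ (by simp), hT₂a 0 one_pos _ hb₁ fun c hc => ?_⟩
    exact ⟨by simpa using hda c hc, hge c (atomConsts_head_subset hcfτ hgv ν hb hc)⟩

/-- Tree-shaped databases are `C`-trees for the subset `C` induced by the root bag. -/
theorem TreeShape.isCTree {T : Database} {X : Set ℕ} (δ : TreeShape T X) :
    IsCTree (dbInst T) (inducedSub (dbInst T) (Sum.inl '' X)) := by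
  have hcover : ∀ a ∈ dbInst T, ∃ t ∈ δ.nodes, ∀ s ∈ a.2, s ∈ Sum.inl '' δ.bags t := by
    rintro _ ⟨f, hf, rfl⟩
    obtain ⟨t, ht, htf⟩ := δ.cover f hf
    refine ⟨t, ht, fun s hs => ?_⟩
    obtain ⟨x, hx, rfl⟩ := List.mem_map.1 hs
    exact ⟨x, htf x hx, rfl⟩
  refine ⟨fun a ha => ha.1, {
    nodes := δ.nodes
    bags := fun t => Sum.inl '' δ.bags t
    root_mem := δ.root_mem
    prefix_closed := δ.prefix_closed
    bags_cover := hcover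
    elem_mem := ?_
    connected := ?_ }, ?_, ?_⟩
  · rintro v ⟨a, ha, hv⟩ -
    obtain ⟨t, ht, hta⟩ := hcover a ha
    exact ⟨t, ht, hta v hv⟩
  · rintro v - t1 ht1 t2 ht2 z hz ⟨x, hx, rfl⟩ ⟨y, hy, hxy⟩ hzt hw
    obtain rfl := Sum.inl_injective hxy
    exact ⟨y, δ.connected y t1 ht1 t2 ht2 z hz hx hy hzt hw, rfl⟩
  · simp only [δ.root_bag]
  · intro t ht ht0
    obtain ⟨f, hf, hft⟩ := δ.guarded t ht ht0
    refine ⟨factAtom f, ⟨f, hf, rfl⟩, ?_⟩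
    rintro _ ⟨x, hx, rfl⟩
    exact List.mem_map_of_mem (hft x hx)

theorem le_arMax {S : RSig} {p : ℕ × ℕ} (hp : p ∈ S) : p.2 ≤ arMax S := by
  induction S with
  | nil => simp at hp
  | cons s S ih =>
    rcases List.mem_cons.1 hp with rfl | hp
    · exact le_max_left _ _
    · exact (ih hp).trans (le_max_right _ _)

/-- Certain answers to constant-free Boolean queries are preserved by homomorphisms which need
not fix constants. -/
theorem certAns_of_hom {Sg : List TGD} (hcf : ∀ τ ∈ Sg, TGDConstFree τ) {q : CQ}
    (hq : q.1 = []) (hqcf : CQConstFree q) {D T : Database} {f : ℕ → ℕ}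
    (hf : ∀ a ∈ T, mapAtom f a ∈ D) (h : [] ∈ certAns Sg q T) : [] ∈ certAns Sg q D := by
  intro J hD hJ
  obtain ⟨e, he⟩ := exists_surjective_nat GTerm
  let g : GTerm → GTerm := Sum.elim (Sum.inl ∘ f) e
  have hg : Function.Surjective g := fun t => (he t).imp' Sum.inr fun _ h => h
  obtain ⟨ν, hν, -⟩ := h {a | mapAtom g a ∈ J}
    (by
      rintro _ ⟨a, ha, rfl⟩
      refine hD ⟨_, hf a ha, ?_⟩
      change mapAtom Sum.inl (mapAtom f a) = mapAtom g (mapAtom Sum.inl a)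
      rw [mapAtom_mapAtom, mapAtom_mapAtom]
      rfl)
    (satAll_pullback (γ := Sum.inl) hg hcf hJ)
  refine ⟨g ∘ ν, fun a ha => ?_, by simp [hq]⟩
  have := hν a ha
  change mapAtom g (mapAtom (Sum.elim Sum.inl ν) a) ∈ J at this
  rwa [mapAtom_comp_elim (γ' := Sum.inl) g (hqcf a ha)] at this

/-- A certain Boolean query under guarded tgds is already certain on an unraveling whose root
bag is covered by one fact for each atom of the query. -/
theorem exists_unraveling_certAns {Sg : List TGD}
    (hG : ∀ τ ∈ Sg, GuardedTGD τ ∧ TGDConstFree τ) {q : CQ} (hq : q.1 = [])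
    (hqcf : CQConstFree q) {D : Database} {k : ℕ} (hk : ∀ d ∈ D, d.2.length ≤ k)
    (h : [] ∈ certAns Sg q D) :
    ∃ (T : Database) (A : Finset ℕ), IsUnraveling D T A ∧ A.card ≤ k * q.2.length ∧
      [] ∈ certAns Sg q T := by
  have hcf : ∀ τ ∈ Sg, TGDConstFree τ := fun τ hτ => (hG τ hτ).2
  obtain ⟨-, ν, hν⟩ := Chase.exists_match hcf hq hqcf h
  choose! d hd hda using fun a ha => (hν a ha).exists_guard hG
  choose! T hT hdT hTa using fun a ha => (hν a ha).exists_unraveling hG (hd a ha) (hda a ha)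
  let A : Finset ℕ := q.2.toFinset.biUnion fun a => (d a).2.toFinset
  obtain ⟨T', hT', -, hT'a⟩ := IsUnraveling.exists_join hcf (D := D) A (B := [])
    (n := q.2.length) (T := fun i => T (q.2.getD i default))
    (X := fun i => {x | x ∈ (d (q.2.getD i default)).2}) (by simp) (fun i hi => by
      have hmem : q.2.getD i default ∈ q.2 := by simp [hi]
      exact ⟨hT _ hmem, _, hdT _ hmem, fun _ h => h⟩)
  refine ⟨T', A, hT', ?_, Chase.certAns_of_match hcf hq hqcf (ν := ν) fun a ha => ?_⟩
  · calc A.card ≤ q.2.toFinset.card * k := Finset.card_biUnion_le_card_mul _ _ _ fun a ha =>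
          (List.toFinset_card_le _).trans (hk _ (hd a (List.mem_toFinset.1 ha)))
      _ ≤ k * q.2.length := by
          rw [mul_comm]
          exact Nat.mul_le_mul_left _ (List.toFinset_card_le _)
  · obtain ⟨i, hi, rfl⟩ := List.getElem_of_mem ha
    refine hT'a i hi _ ?_ fun c hc => ?_
    · simpa [hi] using hTa _ ha
    · have := hda _ ha c hc
      exact ⟨Finset.mem_biUnion.2 ⟨_, List.mem_toFinset.2 ha, List.mem_toFinset.2 this⟩,
        by simpa [hi] using this⟩

end GuardedOMQ

/-- containment of guarded OMQs is witnessed on tree-shaped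
databases.  For OMQs `Q_1 = (S, Σ_1, q_1)` and `Q_2 = (S, Σ_2, q_2)` from
`(G, BCQ)` over the same data schema: `Q_1 ⊆ Q_2` iff `Q_1(D) ⊆ Q_2(D)` for
every `S`-database `D` that is a `C`-tree with
`|adom(C)| ≤ ar(S ∪ sch(Σ_1)) · |q_1|`. -/
theorem statement_14 (S : RSig) (Sg1 Sg2 : List TGD) (q1 q2 : CQ)
    (hG1 : ∀ τ ∈ Sg1, GuardedTGD τ ∧ SingleHead τ ∧ TGDConstFree τ)
    (hG2 : ∀ τ ∈ Sg2, GuardedTGD τ ∧ SingleHead τ ∧ TGDConstFree τ)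
    (hq1 : q1.1 = ([] : List ℕ)) (hcf1 : CQConstFree q1)
    (hq2 : q2.1 = ([] : List ℕ)) (hcf2 : CQConstFree q2) :
    omqContained (S, Sg1, q1) (S, Sg2, q2) ↔
      ∀ D : Database, DBover S D →
        (∃ C : Inst, IsCTree (dbInst D) C ∧
          (instAdom C).ncard ≤ arMax (S ++ schList Sg1) * q1.2.length) →
        omqEval (S, Sg1, q1) D ⊆ omqEval (S, Sg2, q2) D := by
  refine ⟨fun h D hD _ => h D hD, fun h D hD c hc => ?_⟩
  have hG : ∀ τ ∈ Sg1, GuardedTGD τ ∧ TGDConstFree τ := fun τ hτ =>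
    ⟨(hG1 τ hτ).1, (hG1 τ hτ).2.2⟩
  obtain ⟨rfl, -⟩ := GuardedOMQ.Chase.exists_match (fun τ hτ => (hG τ hτ).2) hq1 hcf1 hc
  obtain ⟨T, A, ⟨⟨f, -, hf⟩, ⟨δ⟩⟩, hA, hT⟩ :=
    GuardedOMQ.exists_unraveling_certAns hG hq1 hcf1 (k := arMax (S ++ schList Sg1))
      (fun d hd => GuardedOMQ.le_arMax (List.mem_append_left _ (hD d hd))) hc
  refine GuardedOMQ.certAns_of_hom (fun τ hτ => (hG2 τ hτ).2.2) hq2 hcf2 hf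
    (h T (fun a ha => ?_) ⟨_, δ.isCTree, ?_⟩ hT)
  · simpa [atomOverSig, GuardedOMQ.mapAtom] using hD _ (hf a ha)
  · refine le_trans ?_ hA
    rw [← Set.ncard_coe_finset, ← Set.ncard_image_of_injective (A : Set ℕ) (Sum.inl_injective (β := ℕ))]
    refine Set.ncard_le_ncard ?_ (A.finite_toSet.image _)
    rintro s ⟨a, ha, hs⟩
    exact ha.2 s hs
end
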